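/- arXiv:1912.07302 — 3 statements merged into one kernel-verified Lean document; each statement's English description precedes it below -/
import Mathlib

section
/- For all nonnegative integers t and k, the extended cube graph G = ECG(t,k) satisfies ξ(G) = M(G) = Z(G) = 4. -/
open scoped Classical

noncomputable section

namespace Paper

variable {V : Type*}

/-- The set of vertices eventually colored blue starting from `Z` under the
zero forcing color change rule. -/
inductive Forced (G : SimpleGraph V) (Z : Set V) : V → Prop
  | init (v : V) : v ∈ Z → Forced G Z v
  | force (u w : V) : Forced G Z u → G.Adj u w →
      (∀ x, G.Adj u x → x ≠ w → Forced G Z x) → Forced G Z w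

/-- `Z` is a zero forcing set of `G`. -/
def IsZeroForcingSet (G : SimpleGraph V) (Z : Set V) : Prop := ∀ v, Forced G Z v

/-- The zero forcing number `Z(G)`. -/
def zfn (G : SimpleGraph V) : ℕ :=
  sInf {m | ∃ Z : Set V, Z.ncard = m ∧ IsZeroForcingSet G Z}

/-- Membership in the set `S(F,G)` of symmetric matrices described by `G`. -/
def SMat (F : Type*) [Field F] (G : SimpleGraph V) (A : Matrix V V F) : Prop :=
  A.IsSymm ∧ ∀ i j : V, i ≠ j → (A i j ≠ 0 ↔ G.Adj i j)

/-- Maximum nullity `M(F,G)`. -/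
def maxNullity (F : Type*) [Field F] [Fintype V] (G : SimpleGraph V) : ℕ :=
  sSup {m | ∃ A : Matrix V V F, SMat F G A ∧ Fintype.card V - A.rank = m}

/-- Minimum rank `mr(F,G)`. -/
def minRank (F : Type*) [Field F] [Fintype V] (G : SimpleGraph V) : ℕ :=
  sInf {m | ∃ A : Matrix V V F, SMat F G A ∧ A.rank = m}

/-- The Strong Arnold Property. -/
def HasSAP [Fintype V] [DecidableEq V] (A : Matrix V V ℝ) : Prop :=
  ∀ X : Matrix V V ℝ, X.IsSymm → A * X = 0 → Matrix.hadamard A X = 0 →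
    Matrix.hadamard (1 : Matrix V V ℝ) X = 0 → X = 0

/-- The Colin de Verdière type parameter `ξ(G)`. -/
def xi [Fintype V] [DecidableEq V] (G : SimpleGraph V) : ℕ :=
  sSup {m | ∃ A : Matrix V V ℝ, SMat ℝ G A ∧ HasSAP A ∧ Fintype.card V - A.rank = m}

/-- The adjacency matrix of `G` with entries in `R`. -/
def adjMat (R : Type*) [Zero R] [One R] (G : SimpleGraph V) : Matrix V V R :=
  Matrix.of fun i j => if G.Adj i j then 1 else 0

/-- Minimum degree `δ(G)`. -/
def minDeg (G : SimpleGraph V) : ℕ :=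
  sInf {d | ∃ v : V, (G.neighborSet v).ncard = d}

/-- Vertex connectivity `κ(G)`. -/
def vertexConnectivity [Fintype V] (G : SimpleGraph V) : ℕ :=
  if G = (⊤ : SimpleGraph V) then Fintype.card V - 1
  else sInf {m | ∃ S : Set V, S.ncard = m ∧ ¬ (G.induce Sᶜ).Connected}

/-- The circulant graph `Circ[n,S]`. -/
def circG (n : ℕ) (S : Set ℕ) : SimpleGraph (ZMod n) :=
  SimpleGraph.fromRel (fun i j => ∃ s ∈ S, j = i + (s : ZMod n))


/-- The extended cube graph `ECG(t,k)` on `n = 2t + 2k + 8` vertices. -/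
def ECG (t k : ℕ) : SimpleGraph (ZMod (2 * t + 2 * k + 8)) :=
  SimpleGraph.fromRel (fun a b =>
    b = a + 1 ∨
    (∃ i : ℕ, i ≤ k + 1 ∧ a = (i : ZMod (2 * t + 2 * k + 8)) ∧
      b = ((2 * t + 2 * k + 8 - t - 3 - i : ℕ) : ZMod (2 * t + 2 * k + 8))) ∨
    (∃ i : ℕ, k + 2 ≤ i ∧ i ≤ t + k + 3 ∧ a = (i : ZMod (2 * t + 2 * k + 8)) ∧
      b = ((2 * t + 2 * k + 8 + k + 1 - i : ℕ) : ZMod (2 * t + 2 * k + 8))))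

instance ecgNeZero (t k : ℕ) : NeZero (2 * t + 2 * k + 8) := ⟨by omega⟩

/-! ### Nullity and zero forcing -/

theorem Forced.apply_eq_zero [Fintype V] {G : SimpleGraph V} {A : Matrix V V ℝ}
    (hA : SMat ℝ G A) {Z : Set V} {x : V → ℝ} (hx : A.mulVec x = 0)
    (hZ : ∀ v ∈ Z, x v = 0) {v : V} (hv : Forced G Z v) : x v = 0 := by
  induction hv with
  | init v hv => exact hZ v hv
  | force u w _ huw _ hu hrest =>
    have hrow : ∑ y, A u y * x y = 0 := congrFun hx u
    rw [Finset.sum_eq_single w] at hrow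
    · exact (mul_eq_zero.1 hrow).resolve_left ((hA.2 u w huw.ne).2 huw)
    · intro y _ hyw
      by_cases hyu : y = u
      · rw [hyu, hu, mul_zero]
      by_cases hadj : G.Adj u y
      · rw [hrest y hadj hyw, mul_zero]
      · rw [not_not.1 (mt (hA.2 u y (Ne.symm hyu)).1 hadj), zero_mul]
    · intro h
      exact absurd (Finset.mem_univ w) h

theorem card_sub_rank_eq_finrank_ker [Fintype V] (A : Matrix V V ℝ) :
    Fintype.card V - A.rank = Module.finrank ℝ (LinearMap.ker A.mulVecLin) := by
  have h := A.mulVecLin.finrank_range_add_finrank_ker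
  rw [Module.finrank_fintype_fun_eq_card] at h
  rw [Matrix.rank]
  omega

theorem card_sub_rank_le_ncard [Fintype V] {G : SimpleGraph V} {A : Matrix V V ℝ}
    (hA : SMat ℝ G A) {Z : Set V} (hZ : IsZeroForcingSet G Z) :
    Fintype.card V - A.rank ≤ Z.ncard := by
  rw [card_sub_rank_eq_finrank_ker]
  let φ : LinearMap.ker A.mulVecLin →ₗ[ℝ] (Z → ℝ) :=
    (LinearMap.funLeft ℝ ℝ ((↑) : Z → V)).comp (Submodule.subtype _)
  have hφ : Function.Injective φ := by
    rw [← LinearMap.ker_eq_bot, LinearMap.ker_eq_bot']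
    rintro ⟨x, hx⟩ h
    ext v
    exact (hZ v).apply_eq_zero hA (by simpa using hx) fun w hw => congrFun h ⟨w, hw⟩
  have h := LinearMap.finrank_le_finrank_of_injective hφ
  rwa [Module.finrank_fintype_fun_eq_card, ← Nat.card_eq_fintype_card, Nat.card_coe_set_eq] at h

theorem parameters_eq_of_matrix [Fintype V] [DecidableEq V] {G : SimpleGraph V}
    {A : Matrix V V ℝ} {m : ℕ} {Z : Set V} (hA : SMat ℝ G A) (hSAP : HasSAP A)
    (hrank : m ≤ Fintype.card V - A.rank) (hZ : IsZeroForcingSet G Z) (hcard : Z.ncard ≤ m) :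
    xi G = m ∧ maxNullity ℝ G = m ∧ zfn G = m := by
  have hnull : Fintype.card V - A.rank = m :=
    le_antisymm ((card_sub_rank_le_ncard hA hZ).trans hcard) hrank
  have hZm : Z.ncard = m := le_antisymm hcard (hrank.trans (card_sub_rank_le_ncard hA hZ))
  refine ⟨IsGreatest.csSup_eq ⟨⟨A, hA, hSAP, hnull⟩, ?_⟩,
    IsGreatest.csSup_eq ⟨⟨A, hA, hnull⟩, ?_⟩, IsLeast.csInf_eq ⟨⟨Z, hZm, hZ⟩, ?_⟩⟩
  · rintro _ ⟨B, hB, -, rfl⟩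
    exact (card_sub_rank_le_ncard hB hZ).trans hcard
  · rintro _ ⟨B, hB, rfl⟩
    exact (card_sub_rank_le_ncard hB hZ).trans hcard
  · rintro _ ⟨Y, rfl, hY⟩
    exact hrank.trans (card_sub_rank_le_ncard hA hY)

/-! ### Extended cube graphs in natural number coordinates -/

/-- Adjacency in `ECG t k` in terms of the representatives `0, …, 2t + 2k + 7`. -/
def EcgAdj (t k i j : ℕ) : Prop :=
  i + 1 = j ∨ j + 1 = i ∨ (i = 0 ∧ j = 2 * t + 2 * k + 7) ∨ (j = 0 ∧ i = 2 * t + 2 * k + 7) ∨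
    (i + j = t + 2 * k + 5 ∧ (i ≤ k + 1 ∨ j ≤ k + 1)) ∨
    (i + j = 2 * t + 3 * k + 9 ∧ ((k + 2 ≤ i ∧ i ≤ t + k + 3) ∨ (k + 2 ≤ j ∧ j ≤ t + k + 3)))

theorem zmod_eq_natCast_iff {n : ℕ} [NeZero n] (u : ZMod n) {i : ℕ} (hi : i < n) :
    u = (i : ZMod n) ↔ u.val = i := by
  constructor
  · rintro rfl
    exact ZMod.val_cast_of_lt hi
  · rintro rfl
    exact (ZMod.natCast_rightInverse u).symm

theorem ecg_adj_iff (t k : ℕ) (u v : ZMod (2 * t + 2 * k + 8)) :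
    (ECG t k).Adj u v ↔ EcgAdj t k u.val v.val := by
  have hu := ZMod.val_lt u
  have hv := ZMod.val_lt v
  have hsucc : ∀ a b : ZMod (2 * t + 2 * k + 8), b = a + 1 ↔
      (a.val + 1 = b.val ∨ (b.val = 0 ∧ a.val = 2 * t + 2 * k + 7)) := by
    intro a b
    have ha := ZMod.val_lt a
    have hb := ZMod.val_lt b
    have hcast : a + 1 = ((a.val + 1 : ℕ) : ZMod (2 * t + 2 * k + 8)) := by
      push_cast
      rw [ZMod.natCast_rightInverse a]
    by_cases h : a.val + 1 < 2 * t + 2 * k + 8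
    · rw [hcast, zmod_eq_natCast_iff b h]
      omega
    · have h' : a.val + 1 = 2 * t + 2 * k + 8 := by omega
      rw [hcast, h', ZMod.natCast_self, ← ZMod.val_eq_zero]
      omega
  have hvert : ∀ a b : ZMod (2 * t + 2 * k + 8), (∃ i : ℕ, i ≤ k + 1 ∧
      a = (i : ZMod (2 * t + 2 * k + 8)) ∧
      b = ((2 * t + 2 * k + 8 - t - 3 - i : ℕ) : ZMod (2 * t + 2 * k + 8))) ↔
      (a.val + b.val = t + 2 * k + 5 ∧ a.val ≤ k + 1) := by
    intro a b
    constructor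
    · rintro ⟨i, hi, ha, hb⟩
      rw [zmod_eq_natCast_iff _ (by omega)] at ha hb
      omega
    · rintro ⟨h, ha⟩
      refine ⟨a.val, ha, ?_, ?_⟩ <;> rw [zmod_eq_natCast_iff _ (by omega)]
      omega
  have hhor : ∀ a b : ZMod (2 * t + 2 * k + 8), (∃ i : ℕ, k + 2 ≤ i ∧ i ≤ t + k + 3 ∧
      a = (i : ZMod (2 * t + 2 * k + 8)) ∧
      b = ((2 * t + 2 * k + 8 + k + 1 - i : ℕ) : ZMod (2 * t + 2 * k + 8))) ↔
      (a.val + b.val = 2 * t + 3 * k + 9 ∧ k + 2 ≤ a.val ∧ a.val ≤ t + k + 3) := by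
    intro a b
    constructor
    · rintro ⟨i, hi, hi', ha, hb⟩
      rw [zmod_eq_natCast_iff _ (by omega)] at ha hb
      omega
    · rintro ⟨h, ha, ha'⟩
      refine ⟨a.val, ha, ha', ?_, ?_⟩ <;> rw [zmod_eq_natCast_iff _ (by omega)]
      omega
  have hne : u ≠ v ↔ u.val ≠ v.val := (ZMod.val_injective _).ne_iff.symm
  rw [ECG, SimpleGraph.fromRel_adj, hne, hsucc, hsucc, hvert, hvert, hhor, hhor, EcgAdj]
  omega

/-! ### A zero forcing set of size four -/

/-- The two ends `0`, `t + 2k + 5` of a vertical chord together with the adjacent ends of the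
horizontal ladder. -/
def ecgForcingSet (t k : ℕ) : Set (ZMod (2 * t + 2 * k + 8)) :=
  {((0 : ℕ) : ZMod _), ((t + 2 * k + 5 : ℕ) : ZMod _), ((t + 2 * k + 6 : ℕ) : ZMod _),
    ((2 * t + 2 * k + 7 : ℕ) : ZMod _)}

theorem ecgForcingSet_ncard_le (t k : ℕ) : (ecgForcingSet t k).ncard ≤ 4 := by
  unfold ecgForcingSet
  refine (Set.ncard_insert_le _ _).trans (Nat.succ_le_succ ?_)
  refine (Set.ncard_insert_le _ _).trans (Nat.succ_le_succ ?_)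
  exact (Set.ncard_insert_le _ _).trans (Nat.succ_le_succ (Set.ncard_singleton _).le)

theorem forced_of_three {t k i a b c : ℕ} {Z : Set (ZMod (2 * t + 2 * k + 8))}
    (hi : i < 2 * t + 2 * k + 8) (hc : c < 2 * t + 2 * k + 8)
    (hN : ∀ j, j < 2 * t + 2 * k + 8 → EcgAdj t k i j → j = a ∨ j = b ∨ j = c)
    (hic : EcgAdj t k i c) (fi : Forced (ECG t k) Z (i : ℕ)) (fa : Forced (ECG t k) Z (a : ℕ))
    (fb : Forced (ECG t k) Z (b : ℕ)) : Forced (ECG t k) Z (c : ℕ) := by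
  refine Forced.force _ _ fi ?_ ?_
  · rw [ecg_adj_iff, ZMod.val_cast_of_lt hi, ZMod.val_cast_of_lt hc]
    exact hic
  · intro x hx hxc
    rw [ecg_adj_iff, ZMod.val_cast_of_lt hi] at hx
    have hxv : x = (x.val : ZMod (2 * t + 2 * k + 8)) := (ZMod.natCast_rightInverse x).symm
    rcases hN _ (ZMod.val_lt x) hx with h | h | h
    · rw [hxv, h]
      exact fa
    · rw [hxv, h]
      exact fb
    · rw [h] at hxv
      exact absurd hxv hxc

theorem ecgForcingSet_isZeroForcingSet (t k : ℕ) :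
    IsZeroForcingSet (ECG t k) (ecgForcingSet t k) := by
  set P : ℕ → Prop := fun i => Forced (ECG t k) (ecgForcingSet t k) (i : ℕ) with hP
  have h0 : P 0 := Forced.init _ (by simp [ecgForcingSet])
  have h1 : P (t + 2 * k + 5) := Forced.init _ (by simp [ecgForcingSet])
  have h2 : P (t + 2 * k + 6) := Forced.init _ (by simp [ecgForcingSet])
  have h3 : P (2 * t + 2 * k + 7) := Forced.init _ (by simp [ecgForcingSet])
  have step : ∀ {i a b c : ℕ}, i < 2 * t + 2 * k + 8 → c < 2 * t + 2 * k + 8 →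
      (∀ j, j < 2 * t + 2 * k + 8 → EcgAdj t k i j → j = a ∨ j = b ∨ j = c) →
      EcgAdj t k i c → P i → P a → P b → P c :=
    fun hi hc hN hic fi fa fb => forced_of_three hi hc hN hic fi fa fb
  have first : ∀ j, j ≤ k → (P j ∧ P (t + 2 * k + 5 - j)) ∧
      (P (j + 1) ∧ P (t + 2 * k + 5 - (j + 1))) := by
    intro j
    induction j with
    | zero =>
      intro _
      refine ⟨⟨h0, h1⟩, ?_, ?_⟩
      · exact step (i := 0) (by omega) (by omega) (by unfold EcgAdj; omega)
          (by unfold EcgAdj; omega) h0 h1 h3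
      · exact step (i := t + 2 * k + 5) (by omega) (by omega) (by unfold EcgAdj; omega)
          (by unfold EcgAdj; omega) h1 h0 h2
    | succ j ih =>
      intro hj
      obtain ⟨⟨pa, pc⟩, pa', pc'⟩ := ih (by omega)
      refine ⟨⟨pa', pc'⟩, ?_, ?_⟩
      · exact step (i := j + 1) (by omega) (by omega) (by unfold EcgAdj; omega)
          (by unfold EcgAdj; omega) pa' pa pc'
      · exact step (i := t + 2 * k + 5 - (j + 1)) (by omega) (by omega)
          (by unfold EcgAdj; omega) (by unfold EcgAdj; omega) pc' pc pa'
  have ladder1 : ∀ j, j ≤ k + 1 → P j ∧ P (t + 2 * k + 5 - j) := by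
    intro j hj
    rcases Nat.lt_or_ge j (k + 1) with h | h
    · exact (first j (by omega)).1
    · obtain rfl : j = k + 1 := by omega
      exact (first k le_rfl).2
  have h4 : P (k + 2) := step (i := k + 1) (by omega) (by omega) (by unfold EcgAdj; omega)
    (by unfold EcgAdj; omega) (ladder1 (k + 1) le_rfl).1 (ladder1 k (by omega)).1
    (ladder1 (k + 1) le_rfl).2
  have h5 : P (t + k + 3) := step (i := t + 2 * k + 5 - (k + 1)) (by omega) (by omega)
    (by unfold EcgAdj; omega) (by unfold EcgAdj; omega) (ladder1 (k + 1) le_rfl).2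
    (ladder1 k (by omega)).2 (ladder1 (k + 1) le_rfl).1
  have second : ∀ j, j ≤ t → (P (k + 2 + j) ∧ P (2 * t + 2 * k + 7 - j)) ∧
      (P (k + 2 + (j + 1)) ∧ P (2 * t + 2 * k + 7 - (j + 1))) := by
    intro j
    induction j with
    | zero =>
      intro _
      refine ⟨⟨h4, h3⟩, ?_, ?_⟩
      · exact step (i := k + 2) (by omega) (by omega) (by unfold EcgAdj; omega)
          (by unfold EcgAdj; omega) h4 h3 (ladder1 (k + 1) le_rfl).1
      · exact step (i := 2 * t + 2 * k + 7) (by omega) (by omega) (by unfold EcgAdj; omega)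
          (by unfold EcgAdj; omega) h3 h4 h0
    | succ j ih =>
      intro hj
      obtain ⟨⟨pb, pd⟩, pb', pd'⟩ := ih (by omega)
      refine ⟨⟨pb', pd'⟩, ?_, ?_⟩
      · exact step (i := k + 2 + (j + 1)) (by omega) (by omega) (by unfold EcgAdj; omega)
          (by unfold EcgAdj; omega) pb' pb pd'
      · exact step (i := 2 * t + 2 * k + 7 - (j + 1)) (by omega) (by omega)
          (by unfold EcgAdj; omega) (by unfold EcgAdj; omega) pd' pd pb'
  have ladder2 : ∀ j, j ≤ t + 1 → P (k + 2 + j) ∧ P (2 * t + 2 * k + 7 - j) := by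
    intro j hj
    rcases Nat.lt_or_ge j (t + 1) with h | h
    · exact (second j (by omega)).1
    · obtain rfl : j = t + 1 := by omega
      exact (second t le_rfl).2
  intro v
  have hv := ZMod.val_lt v
  have key : P v.val := by
    rcases Nat.lt_or_ge v.val (k + 2) with h | h
    · exact (ladder1 _ (by omega)).1
    rcases Nat.lt_or_ge v.val (t + k + 4) with h' | h'
    · have := (ladder2 (v.val - (k + 2)) (by omega)).1
      rwa [Nat.add_sub_cancel' h] at this
    rcases Nat.lt_or_ge v.val (t + 2 * k + 6) with h'' | h''
    · have := (ladder1 (t + 2 * k + 5 - v.val) (by omega)).2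
      rwa [Nat.sub_sub_self (by omega)] at this
    · have := (ladder2 (2 * t + 2 * k + 7 - v.val) (by omega)).2
      rwa [Nat.sub_sub_self (by omega)] at this
  have hvv : v = (v.val : ZMod (2 * t + 2 * k + 8)) := (ZMod.natCast_rightInverse v).symm
  rw [hvv]
  exact key

/-! ### The weighted adjacency matrix -/

/-- The four ends of the ladder formed by the vertical chords. -/
def VertCorner (t k i : ℕ) : Prop :=
  i = 0 ∨ i = k + 1 ∨ i = t + k + 4 ∨ i = t + 2 * k + 5

/-- The four ends of the ladder formed by the horizontal chords. -/
def HorCorner (t k i : ℕ) : Prop :=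
  i = k + 2 ∨ i = t + k + 3 ∨ i = t + 2 * k + 6 ∨ i = 2 * t + 2 * k + 7

/-- The vertices of the ladder formed by the vertical chords. -/
def VertLadder (t k i : ℕ) : Prop :=
  i ≤ k + 1 ∨ (t + k + 4 ≤ i ∧ i ≤ t + 2 * k + 5)

/-- A weighting of `ECG t k`: the ladders carry the diagonal entries `d₁`, `b * d₂` and the rung
weights `r₁`, `b * r₂` at their ends, and inside they are weighted so that null vectors are
(alternating) affine functions along the rails. -/
def ecgWeight (t k : ℕ) (d₁ r₁ d₂ r₂ b : ℝ) (i j : ℕ) : ℝ :=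
  if i = j then
    if VertCorner t k i then d₁ else if HorCorner t k i then b * d₂ else 0
  else if EcgAdj t k i j then
    if VertLadder t k i then
      if VertLadder t k j then
        if i + j = t + 2 * k + 5 then
          if VertCorner t k i then r₁ else -((k : ℝ) + 1)
        else ((k : ℝ) + 1) / 2
      else 1
    else if VertLadder t k j then 1
    else if i + j = 2 * t + 3 * k + 9 then
      if HorCorner t k i then b * r₂ else -(b * ((t : ℝ) + 1))
    else b * (((t : ℝ) + 1) / 2)
  else 0

theorem ecgWeight_symm {t k : ℕ} (d₁ r₁ d₂ r₂ b : ℝ) {i j : ℕ}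
    (hi : i < 2 * t + 2 * k + 8) (hj : j < 2 * t + 2 * k + 8) :
    ecgWeight t k d₁ r₁ d₂ r₂ b i j = ecgWeight t k d₁ r₁ d₂ r₂ b j i := by
  by_cases hij : i = j
  · rw [hij]
  have hadj : EcgAdj t k j i ↔ EcgAdj t k i j := by unfold EcgAdj; omega
  by_cases h : EcgAdj t k i j
  · have hv : i + j = t + 2 * k + 5 → VertLadder t k i → (VertCorner t k j ↔ VertCorner t k i) := by
      unfold VertCorner VertLadder
      omega
    have hh : i + j = 2 * t + 3 * k + 9 → ¬ VertLadder t k i →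
        (HorCorner t k j ↔ HorCorner t k i) := by
      unfold HorCorner VertLadder
      omega
    simp only [ecgWeight, hij, Ne.symm hij, hadj, h, if_true, if_false, add_comm j i]
    by_cases li : VertLadder t k i <;> by_cases lj : VertLadder t k j <;>
      simp only [li, lj, if_true, if_false]
    · by_cases e : i + j = t + 2 * k + 5
      · simp only [e, hv e li]
      · simp only [e, if_false]
    · by_cases e : i + j = 2 * t + 3 * k + 9
      · simp only [e, hh e li]
      · simp only [e, if_false]
  · simp only [ecgWeight, hij, Ne.symm hij, hadj, h, if_false]

theorem ecgWeight_ne_zero_iff {t k : ℕ} {d₁ r₁ d₂ r₂ b : ℝ} (hr₁ : r₁ ≠ 0) (hr₂ : r₂ ≠ 0)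
    (hb : b ≠ 0) {i j : ℕ} (hij : i ≠ j) :
    ecgWeight t k d₁ r₁ d₂ r₂ b i j ≠ 0 ↔ EcgAdj t k i j := by
  have hk : (k : ℝ) + 1 ≠ 0 := by positivity
  have ht : (t : ℝ) + 1 ≠ 0 := by positivity
  have hk' : -1 + -(k : ℝ) ≠ 0 := fun h => hk (by linarith)
  unfold ecgWeight
  split_ifs <;> simp_all

/-- The matrix of `ecgWeight`. -/
def ecgMatrix (t k : ℕ) (d₁ r₁ d₂ r₂ b : ℝ) :
    Matrix (ZMod (2 * t + 2 * k + 8)) (ZMod (2 * t + 2 * k + 8)) ℝ :=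
  Matrix.of fun u v => ecgWeight t k d₁ r₁ d₂ r₂ b u.val v.val

theorem ecgMatrix_sMat {t k : ℕ} {d₁ r₁ d₂ r₂ b : ℝ} (hr₁ : r₁ ≠ 0) (hr₂ : r₂ ≠ 0)
    (hb : b ≠ 0) : SMat ℝ (ECG t k) (ecgMatrix t k d₁ r₁ d₂ r₂ b) := by
  constructor
  · ext u v
    exact ecgWeight_symm _ _ _ _ _ (ZMod.val_lt v) (ZMod.val_lt u)
  · intro u v huv
    rw [ecg_adj_iff]
    exact ecgWeight_ne_zero_iff hr₁ hr₂ hb ((ZMod.val_injective _).ne huv)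

theorem sum_zmod_val {n : ℕ} [NeZero n] (h : ℕ → ℝ) :
    ∑ v : ZMod n, h v.val = ∑ j ∈ Finset.range n, h j := by
  refine Finset.sum_nbij ZMod.val (fun v _ => Finset.mem_range.2 (ZMod.val_lt v))
    (ZMod.val_injective n).injOn ?_ fun _ _ => rfl
  intro j hj
  exact ⟨(j : ZMod n), by simp, ZMod.val_cast_of_lt (by simpa using hj)⟩

theorem sum_ecgWeight_mul {t k : ℕ} (d₁ r₁ d₂ r₂ b : ℝ) (x : ℕ → ℝ) {i a c e : ℕ}
    (hi : i < 2 * t + 2 * k + 8) (ha : a < 2 * t + 2 * k + 8) (hc : c < 2 * t + 2 * k + 8)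
    (he : e < 2 * t + 2 * k + 8) (hac : a ≠ c) (hae : a ≠ e) (hce : c ≠ e)
    (hia : i ≠ a) (hic : i ≠ c) (hie : i ≠ e)
    (hN : ∀ j, j < 2 * t + 2 * k + 8 → EcgAdj t k i j → j = a ∨ j = c ∨ j = e) :
    ∑ j ∈ Finset.range (2 * t + 2 * k + 8), ecgWeight t k d₁ r₁ d₂ r₂ b i j * x j =
      ecgWeight t k d₁ r₁ d₂ r₂ b i i * x i + ecgWeight t k d₁ r₁ d₂ r₂ b i a * x a +
      ecgWeight t k d₁ r₁ d₂ r₂ b i c * x c + ecgWeight t k d₁ r₁ d₂ r₂ b i e * x e := by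
  rw [← Finset.sum_subset (s₁ := {i, a, c, e})]
  · rw [Finset.sum_insert (by simp [hia, hic, hie]), Finset.sum_insert (by simp [hac, hae]),
      Finset.sum_insert (by simp [hce]), Finset.sum_singleton]
    ring
  · intro j hj
    simp only [Finset.mem_insert, Finset.mem_singleton] at hj
    rw [Finset.mem_range]
    omega
  · intro j hj hj'
    rw [Finset.mem_range] at hj
    simp only [Finset.mem_insert, Finset.mem_singleton, not_or] at hj'
    have hadj : ¬ EcgAdj t k i j := fun h => by
      have := hN j hj h
      tauto
    rw [ecgWeight, if_neg (Ne.symm hj'.1), if_neg hadj, zero_mul]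

/-! ### Null vectors -/

/-- A null function along a rail of a ladder with `m + 2` rungs, for the rail-swapping sign `α`,
with value `1` at the first rung and `β` at the last one. -/
def railFun (α β : ℝ) (m i : ℕ) : ℝ :=
  α ^ i * (1 - (1 - β * α ^ (m + 1)) * i / (m + 1))

theorem railFun_zero (α β : ℝ) (m : ℕ) : railFun α β m 0 = 1 := by
  simp [railFun]

theorem railFun_last {α : ℝ} (β : ℝ) (m : ℕ) (hα : α ^ 2 = 1) : railFun α β m (m + 1) = β := by
  have hm : (m : ℝ) + 1 ≠ 0 := by positivity
  have h : (α ^ (m + 1)) ^ 2 = 1 := by rw [← pow_mul, mul_comm, pow_mul, hα, one_pow]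
  rw [railFun]
  push_cast
  rw [mul_div_assoc, div_self hm]
  linear_combination β * h

theorem railFun_one (α β : ℝ) (m : ℕ) : ((m : ℝ) + 1) / 2 * railFun α β m 1 =
    α * (((m : ℝ) + 1) / 2 - (1 - β * α ^ (m + 1)) / 2) := by
  have hm : (m : ℝ) + 1 ≠ 0 := by positivity
  rw [railFun]
  field_simp
  push_cast
  ring

theorem railFun_pred_last {α β : ℝ} (m : ℕ) (hα : α ^ 2 = 1) (hβ : β ^ 2 = 1) :
    ((m : ℝ) + 1) / 2 * railFun α β m m =
      α * β * (((m : ℝ) + 1) / 2 - (1 - β * α ^ (m + 1)) / 2) := by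
  have hm : (m : ℝ) + 1 ≠ 0 := by positivity
  have h : (α ^ m) ^ 2 = 1 := by rw [← pow_mul, mul_comm, pow_mul, hα, one_pow]
  have e : ((m : ℝ) + 1) / 2 * railFun α β m m =
      α ^ m * (((m : ℝ) + 1) - (1 - β * α ^ (m + 1)) * m) / 2 := by
    rw [railFun]
    field_simp
  rw [e, pow_succ]
  linear_combination α * β * m / 2 * h - α ^ m / 2 * β ^ 2 * hα - α ^ m / 2 * hβ

theorem railFun_add_two {α : ℝ} (β : ℝ) (m i : ℕ) (hα : α ^ 2 = 1) :
    railFun α β m i + railFun α β m (i + 2) = 2 * α * railFun α β m (i + 1) := by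
  have hm : (m : ℝ) + 1 ≠ 0 := by positivity
  simp only [railFun]
  rw [pow_add α i 2, pow_succ α i, hα]
  push_cast
  have : α ^ i * α * α = α ^ i := by rw [mul_assoc, ← sq, hα, mul_one]
  field_simp
  linear_combination (-2) * (m + 1 - (1 - β * α ^ (m + 1)) * (i + 1)) * this

/-- A null vector of the weighting `ecgWeight`, in natural number coordinates. Its values on the
two ends of a rung of the vertical ladder differ by the sign `α`, those on the two ends of a rung
of the horizontal ladder by the sign `β`. -/
def nullFun (t k : ℕ) (α β s : ℝ) (i : ℕ) : ℝ :=
  if i ≤ k + 1 then railFun α β k i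
  else if i ≤ t + k + 3 then β * s * railFun β α t (i - (k + 2))
  else if i ≤ t + 2 * k + 5 then α * railFun α β k (t + 2 * k + 5 - i)
  else s * railFun β α t (2 * t + 2 * k + 7 - i)

section

variable (t k : ℕ) (α β s : ℝ) {j : ℕ}

theorem nullFun_of_le (hj : j ≤ k + 1) : nullFun t k α β s j = railFun α β k j := by
  rw [nullFun, if_pos hj]

theorem nullFun_add (hj : j ≤ t + 1) :
    nullFun t k α β s (k + 2 + j) = β * s * railFun β α t j := by
  rw [nullFun, if_neg (by omega), if_pos (by omega), Nat.add_sub_cancel_left]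

theorem nullFun_vert_sub (hj : j ≤ k + 1) :
    nullFun t k α β s (t + 2 * k + 5 - j) = α * railFun α β k j := by
  rw [nullFun, if_neg (by omega), if_neg (by omega), if_pos (by omega),
    Nat.sub_sub_self (by omega)]

theorem nullFun_hor_sub (hj : j ≤ t + 1) :
    nullFun t k α β s (2 * t + 2 * k + 7 - j) = s * railFun β α t j := by
  rw [nullFun, if_neg (by omega), if_neg (by omega), if_neg (by omega),
    Nat.sub_sub_self (by omega)]

end

section

variable {t k : ℕ} {d₁ r₁ d₂ r₂ b : ℝ} {i j : ℕ}

theorem ecgWeight_self_vert (h : VertCorner t k i) : ecgWeight t k d₁ r₁ d₂ r₂ b i i = d₁ := by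
  simp [ecgWeight, h]

theorem ecgWeight_self_hor (h : HorCorner t k i) :
    ecgWeight t k d₁ r₁ d₂ r₂ b i i = b * d₂ := by
  have : ¬ VertCorner t k i := by
    unfold HorCorner at h
    unfold VertCorner
    omega
  simp [ecgWeight, h, this]

theorem ecgWeight_self (h : ¬ VertCorner t k i) (h' : ¬ HorCorner t k i) :
    ecgWeight t k d₁ r₁ d₂ r₂ b i i = 0 := by
  simp [ecgWeight, h, h']

theorem ecgWeight_conn (h : EcgAdj t k i j) (hl : VertLadder t k i ↔ ¬ VertLadder t k j) :
    ecgWeight t k d₁ r₁ d₂ r₂ b i j = 1 := by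
  have hij : i ≠ j := by
    rintro rfl
    tauto
  by_cases lj : VertLadder t k j <;> simp_all [ecgWeight]

theorem ecgWeight_vert_rail (h : EcgAdj t k i j) (hij : i ≠ j) (li : VertLadder t k i)
    (lj : VertLadder t k j) (hs : i + j ≠ t + 2 * k + 5) :
    ecgWeight t k d₁ r₁ d₂ r₂ b i j = ((k : ℝ) + 1) / 2 := by
  simp [ecgWeight, *]

theorem ecgWeight_vert_end (h : EcgAdj t k i j) (hij : i ≠ j) (li : VertLadder t k i)
    (lj : VertLadder t k j) (hs : i + j = t + 2 * k + 5) (hc : VertCorner t k i) :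
    ecgWeight t k d₁ r₁ d₂ r₂ b i j = r₁ := by
  simp [ecgWeight, *]

theorem ecgWeight_vert_rung (h : EcgAdj t k i j) (hij : i ≠ j) (li : VertLadder t k i)
    (lj : VertLadder t k j) (hs : i + j = t + 2 * k + 5) (hc : ¬ VertCorner t k i) :
    ecgWeight t k d₁ r₁ d₂ r₂ b i j = -((k : ℝ) + 1) := by
  rw [ecgWeight, if_neg hij, if_pos h, if_pos li, if_pos lj, if_pos hs, if_neg hc]

theorem ecgWeight_hor_rail (h : EcgAdj t k i j) (hij : i ≠ j) (li : ¬ VertLadder t k i)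
    (lj : ¬ VertLadder t k j) (hs : i + j ≠ 2 * t + 3 * k + 9) :
    ecgWeight t k d₁ r₁ d₂ r₂ b i j = b * (((t : ℝ) + 1) / 2) := by
  simp [ecgWeight, *]

theorem ecgWeight_hor_end (h : EcgAdj t k i j) (hij : i ≠ j) (li : ¬ VertLadder t k i)
    (lj : ¬ VertLadder t k j) (hs : i + j = 2 * t + 3 * k + 9) (hc : HorCorner t k i) :
    ecgWeight t k d₁ r₁ d₂ r₂ b i j = b * r₂ := by
  simp [ecgWeight, *]

theorem ecgWeight_hor_rung (h : EcgAdj t k i j) (hij : i ≠ j) (li : ¬ VertLadder t k i)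
    (lj : ¬ VertLadder t k j) (hs : i + j = 2 * t + 3 * k + 9) (hc : ¬ HorCorner t k i) :
    ecgWeight t k d₁ r₁ d₂ r₂ b i j = -(b * ((t : ℝ) + 1)) := by
  rw [ecgWeight, if_neg hij, if_pos h, if_neg li, if_neg lj, if_pos hs, if_neg hc]

end

theorem sum_ecgWeight_mul_nullFun_vert {t k : ℕ} {d₁ r₁ b α β s : ℝ}
    (d₂ r₂ : ℝ) (hα : α ^ 2 = 1) (hβ : β ^ 2 = 1)
    (hs : s + d₁ + α * (r₁ + ((k : ℝ) + 1) / 2) - α * (1 - β * α ^ (k + 1)) / 2 = 0)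
    {i : ℕ} (hi : i < 2 * t + 2 * k + 8) (hl : VertLadder t k i) :
    ∑ j ∈ Finset.range (2 * t + 2 * k + 8),
      ecgWeight t k d₁ r₁ d₂ r₂ b i j * nullFun t k α β s j = 0 := by
  have hcases : (i = 0 ∨ i = k + 1 ∨ i = t + 2 * k + 5 - 0 ∨ i = t + 2 * k + 5 - (k + 1)) ∨
      ∃ j, j + 1 ≤ k ∧ (i = j + 1 ∨ i = t + 2 * k + 5 - (j + 1)) := by
    unfold VertLadder at hl
    by_contra! hne
    obtain ⟨h₁, h₂⟩ := hne
    have hA := h₂ (i - 1)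
    have hC := h₂ (t + 2 * k + 5 - i - 1)
    omega
  obtain (rfl | rfl | rfl | rfl) | ⟨j, hj, rfl | rfl⟩ := hcases
  · rw [sum_ecgWeight_mul d₁ r₁ d₂ r₂ b (nullFun t k α β s)
        (i := 0) (a := 1) (c := t + 2 * k + 5 - 0)
        (e := 2 * t + 2 * k + 7 - 0)
        (by omega) (by omega) (by omega) (by omega) (by omega)
        (by omega) (by omega) (by omega) (by omega) (by omega) (by unfold EcgAdj; omega),
      ecgWeight_self_vert (t := t) (k := k) (i := 0)
        (by unfold VertCorner; omega),
      ecgWeight_vert_rail (t := t) (k := k) (i := 0) (j := 1)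
        (by unfold EcgAdj; omega) (by omega) (by unfold VertLadder; omega)
        (by unfold VertLadder; omega) (by omega),
      ecgWeight_vert_end (t := t) (k := k) (i := 0) (j := t + 2 * k + 5 - 0)
        (by unfold EcgAdj; omega) (by omega) (by unfold VertLadder; omega)
        (by unfold VertLadder; omega) (by omega) (by unfold VertCorner; omega),
      ecgWeight_conn (t := t) (k := k) (i := 0) (j := 2 * t + 2 * k + 7 - 0)
        (by unfold EcgAdj; omega) (by unfold VertLadder; omega),
      nullFun_of_le t k α β s (j := 0) (by omega),
      nullFun_of_le t k α β s (j := 1) (by omega),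
      nullFun_vert_sub t k α β s (j := 0) (by omega),
      nullFun_hor_sub t k α β s (j := 0) (by omega)]
    simp only [railFun_zero]
    linear_combination hs + railFun_one α β k
  · rw [sum_ecgWeight_mul d₁ r₁ d₂ r₂ b (nullFun t k α β s)
        (i := k + 1) (a := k) (c := t + 2 * k + 5 - (k + 1))
        (e := k + 2 + 0)
        (by omega) (by omega) (by omega) (by omega) (by omega)
        (by omega) (by omega) (by omega) (by omega) (by omega) (by unfold EcgAdj; omega),
      ecgWeight_self_vert (t := t) (k := k) (i := k + 1)
        (by unfold VertCorner; omega),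
      ecgWeight_vert_rail (t := t) (k := k) (i := k + 1) (j := k)
        (by unfold EcgAdj; omega) (by omega) (by unfold VertLadder; omega)
        (by unfold VertLadder; omega) (by omega),
      ecgWeight_vert_end (t := t) (k := k) (i := k + 1) (j := t + 2 * k + 5 - (k + 1))
        (by unfold EcgAdj; omega) (by omega) (by unfold VertLadder; omega)
        (by unfold VertLadder; omega) (by omega) (by unfold VertCorner; omega),
      ecgWeight_conn (t := t) (k := k) (i := k + 1) (j := k + 2 + 0)
        (by unfold EcgAdj; omega) (by unfold VertLadder; omega),
      nullFun_of_le t k α β s (j := k + 1) (by omega),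
      nullFun_of_le t k α β s (j := k) (by omega),
      nullFun_vert_sub t k α β s (j := k + 1) (by omega),
      nullFun_add t k α β s (j := 0) (by omega)]
    simp only [railFun_zero, railFun_last _ _ hα]
    linear_combination β * hs + railFun_pred_last k hα hβ
  · rw [sum_ecgWeight_mul d₁ r₁ d₂ r₂ b (nullFun t k α β s)
        (i := t + 2 * k + 5 - 0) (a := t + 2 * k + 5 - 1) (c := 0)
        (e := 2 * t + 2 * k + 7 - (t + 1))
        (by omega) (by omega) (by omega) (by omega) (by omega)
        (by omega) (by omega) (by omega) (by omega) (by omega) (by unfold EcgAdj; omega),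
      ecgWeight_self_vert (t := t) (k := k) (i := t + 2 * k + 5 - 0)
        (by unfold VertCorner; omega),
      ecgWeight_vert_rail (t := t) (k := k) (i := t + 2 * k + 5 - 0) (j := t + 2 * k + 5 - 1)
        (by unfold EcgAdj; omega) (by omega) (by unfold VertLadder; omega)
        (by unfold VertLadder; omega) (by omega),
      ecgWeight_vert_end (t := t) (k := k) (i := t + 2 * k + 5 - 0) (j := 0)
        (by unfold EcgAdj; omega) (by omega) (by unfold VertLadder; omega)
        (by unfold VertLadder; omega) (by omega) (by unfold VertCorner; omega),
      ecgWeight_conn (t := t) (k := k) (i := t + 2 * k + 5 - 0) (j := 2 * t + 2 * k + 7 - (t + 1))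
        (by unfold EcgAdj; omega) (by unfold VertLadder; omega),
      nullFun_vert_sub t k α β s (j := 0) (by omega),
      nullFun_vert_sub t k α β s (j := 1) (by omega),
      nullFun_of_le t k α β s (j := 0) (by omega),
      nullFun_hor_sub t k α β s (j := t + 1) (by omega)]
    simp only [railFun_zero, railFun_last _ _ hβ]
    linear_combination α * hs + α * railFun_one α β k - r₁ * hα
  · rw [sum_ecgWeight_mul d₁ r₁ d₂ r₂ b (nullFun t k α β s)
        (i := t + 2 * k + 5 - (k + 1)) (a := t + 2 * k + 5 - k) (c := k + 1)
        (e := k + 2 + (t + 1))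
        (by omega) (by omega) (by omega) (by omega) (by omega)
        (by omega) (by omega) (by omega) (by omega) (by omega) (by unfold EcgAdj; omega),
      ecgWeight_self_vert (t := t) (k := k) (i := t + 2 * k + 5 - (k + 1))
        (by unfold VertCorner; omega),
      ecgWeight_vert_rail (t := t) (k := k) (i := t + 2 * k + 5 - (k + 1)) (j := t + 2 * k + 5 - k)
        (by unfold EcgAdj; omega) (by omega) (by unfold VertLadder; omega)
        (by unfold VertLadder; omega) (by omega),
      ecgWeight_vert_end (t := t) (k := k) (i := t + 2 * k + 5 - (k + 1)) (j := k + 1)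
        (by unfold EcgAdj; omega) (by omega) (by unfold VertLadder; omega)
        (by unfold VertLadder; omega) (by omega) (by unfold VertCorner; omega),
      ecgWeight_conn (t := t) (k := k) (i := t + 2 * k + 5 - (k + 1)) (j := k + 2 + (t + 1))
        (by unfold EcgAdj; omega) (by unfold VertLadder; omega),
      nullFun_vert_sub t k α β s (j := k + 1) (by omega),
      nullFun_vert_sub t k α β s (j := k) (by omega),
      nullFun_of_le t k α β s (j := k + 1) (by omega),
      nullFun_add t k α β s (j := t + 1) (by omega)]
    simp only [railFun_last _ _ hα, railFun_last _ _ hβ]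
    linear_combination α * β * hs + α * railFun_pred_last k hα hβ - β * r₁ * hα
  · rw [sum_ecgWeight_mul d₁ r₁ d₂ r₂ b (nullFun t k α β s)
        (i := j + 1) (a := j) (c := j + 2)
        (e := t + 2 * k + 5 - (j + 1))
        (by omega) (by omega) (by omega) (by omega) (by omega)
        (by omega) (by omega) (by omega) (by omega) (by omega) (by unfold EcgAdj; omega),
      ecgWeight_self (t := t) (k := k) (i := j + 1)
        (by unfold VertCorner; omega) (by unfold HorCorner; omega),
      ecgWeight_vert_rail (t := t) (k := k) (i := j + 1) (j := j)
        (by unfold EcgAdj; omega) (by omega) (by unfold VertLadder; omega)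
        (by unfold VertLadder; omega) (by omega),
      ecgWeight_vert_rail (t := t) (k := k) (i := j + 1) (j := j + 2)
        (by unfold EcgAdj; omega) (by omega) (by unfold VertLadder; omega)
        (by unfold VertLadder; omega) (by omega),
      ecgWeight_vert_rung (t := t) (k := k) (i := j + 1) (j := t + 2 * k + 5 - (j + 1))
        (by unfold EcgAdj; omega) (by omega) (by unfold VertLadder; omega)
        (by unfold VertLadder; omega) (by omega) (by unfold VertCorner; omega),
      nullFun_of_le t k α β s (j := j + 1) (by omega),
      nullFun_of_le t k α β s (j := j) (by omega),
      nullFun_of_le t k α β s (j := j + 2) (by omega),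
      nullFun_vert_sub t k α β s (j := j + 1) (by omega)]
    linear_combination ((k : ℝ) + 1) / 2 * railFun_add_two β k j hα
  · rw [sum_ecgWeight_mul d₁ r₁ d₂ r₂ b (nullFun t k α β s)
        (i := t + 2 * k + 5 - (j + 1)) (a := t + 2 * k + 5 - j) (c := t + 2 * k + 5 - (j + 2))
        (e := j + 1)
        (by omega) (by omega) (by omega) (by omega) (by omega)
        (by omega) (by omega) (by omega) (by omega) (by omega) (by unfold EcgAdj; omega),
      ecgWeight_self (t := t) (k := k) (i := t + 2 * k + 5 - (j + 1))
        (by unfold VertCorner; omega) (by unfold HorCorner; omega),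
      ecgWeight_vert_rail (t := t) (k := k) (i := t + 2 * k + 5 - (j + 1)) (j := t + 2 * k + 5 - j)
        (by unfold EcgAdj; omega) (by omega) (by unfold VertLadder; omega)
        (by unfold VertLadder; omega) (by omega),
      ecgWeight_vert_rail (t := t) (k := k) (i := t + 2 * k + 5 - (j + 1)) (j := t + 2 * k + 5 - (j + 2))
        (by unfold EcgAdj; omega) (by omega) (by unfold VertLadder; omega)
        (by unfold VertLadder; omega) (by omega),
      ecgWeight_vert_rung (t := t) (k := k) (i := t + 2 * k + 5 - (j + 1)) (j := j + 1)
        (by unfold EcgAdj; omega) (by omega) (by unfold VertLadder; omega)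
        (by unfold VertLadder; omega) (by omega) (by unfold VertCorner; omega),
      nullFun_vert_sub t k α β s (j := j + 1) (by omega),
      nullFun_vert_sub t k α β s (j := j) (by omega),
      nullFun_vert_sub t k α β s (j := j + 2) (by omega),
      nullFun_of_le t k α β s (j := j + 1) (by omega)]
    linear_combination ((k : ℝ) + 1) / 2 * α * railFun_add_two β k j hα +
        ((k : ℝ) + 1) * railFun α β k (j + 1) * hα

theorem sum_ecgWeight_mul_nullFun_hor {t k : ℕ} {d₂ r₂ b α β s : ℝ}
    (d₁ r₁ : ℝ) (hα : α ^ 2 = 1) (hβ : β ^ 2 = 1)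
    (hs : 1 + b * s * (d₂ + β * (r₂ + ((t : ℝ) + 1) / 2) - β * (1 - α * β ^ (t + 1)) / 2) = 0)
    {i : ℕ} (hi : i < 2 * t + 2 * k + 8) (hl : ¬ VertLadder t k i) :
    ∑ j ∈ Finset.range (2 * t + 2 * k + 8),
      ecgWeight t k d₁ r₁ d₂ r₂ b i j * nullFun t k α β s j = 0 := by
  have hcases : (i = k + 2 + 0 ∨ i = k + 2 + (t + 1) ∨ i = 2 * t + 2 * k + 7 - 0 ∨ i = 2 * t + 2 * k + 7 - (t + 1)) ∨
      ∃ j, j + 1 ≤ t ∧ (i = k + 2 + (j + 1) ∨ i = 2 * t + 2 * k + 7 - (j + 1)) := by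
    unfold VertLadder at hl
    by_contra! hne
    obtain ⟨h₁, h₂⟩ := hne
    have hB := h₂ (i - (k + 2) - 1)
    have hD := h₂ (2 * t + 2 * k + 7 - i - 1)
    omega
  obtain (rfl | rfl | rfl | rfl) | ⟨j, hj, rfl | rfl⟩ := hcases
  · rw [sum_ecgWeight_mul d₁ r₁ d₂ r₂ b (nullFun t k α β s)
        (i := k + 2 + 0) (a := k + 2 + 1) (c := 2 * t + 2 * k + 7 - 0)
        (e := k + 1)
        (by omega) (by omega) (by omega) (by omega) (by omega)
        (by omega) (by omega) (by omega) (by omega) (by omega) (by unfold EcgAdj; omega),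
      ecgWeight_self_hor (t := t) (k := k) (i := k + 2 + 0)
        (by unfold HorCorner; omega),
      ecgWeight_hor_rail (t := t) (k := k) (i := k + 2 + 0) (j := k + 2 + 1)
        (by unfold EcgAdj; omega) (by omega) (by unfold VertLadder; omega)
        (by unfold VertLadder; omega) (by omega),
      ecgWeight_hor_end (t := t) (k := k) (i := k + 2 + 0) (j := 2 * t + 2 * k + 7 - 0)
        (by unfold EcgAdj; omega) (by omega) (by unfold VertLadder; omega)
        (by unfold VertLadder; omega) (by omega) (by unfold HorCorner; omega),
      ecgWeight_conn (t := t) (k := k) (i := k + 2 + 0) (j := k + 1)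
        (by unfold EcgAdj; omega) (by unfold VertLadder; omega),
      nullFun_add t k α β s (j := 0) (by omega),
      nullFun_add t k α β s (j := 1) (by omega),
      nullFun_hor_sub t k α β s (j := 0) (by omega),
      nullFun_of_le t k α β s (j := k + 1) (by omega)]
    simp only [railFun_zero, railFun_last _ _ hα]
    linear_combination β * hs + b * s * β * railFun_one β α t - b * s * r₂ * hβ
  · rw [sum_ecgWeight_mul d₁ r₁ d₂ r₂ b (nullFun t k α β s)
        (i := k + 2 + (t + 1)) (a := k + 2 + t) (c := 2 * t + 2 * k + 7 - (t + 1))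
        (e := t + 2 * k + 5 - (k + 1))
        (by omega) (by omega) (by omega) (by omega) (by omega)
        (by omega) (by omega) (by omega) (by omega) (by omega) (by unfold EcgAdj; omega),
      ecgWeight_self_hor (t := t) (k := k) (i := k + 2 + (t + 1))
        (by unfold HorCorner; omega),
      ecgWeight_hor_rail (t := t) (k := k) (i := k + 2 + (t + 1)) (j := k + 2 + t)
        (by unfold EcgAdj; omega) (by omega) (by unfold VertLadder; omega)
        (by unfold VertLadder; omega) (by omega),
      ecgWeight_hor_end (t := t) (k := k) (i := k + 2 + (t + 1)) (j := 2 * t + 2 * k + 7 - (t + 1))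
        (by unfold EcgAdj; omega) (by omega) (by unfold VertLadder; omega)
        (by unfold VertLadder; omega) (by omega) (by unfold HorCorner; omega),
      ecgWeight_conn (t := t) (k := k) (i := k + 2 + (t + 1)) (j := t + 2 * k + 5 - (k + 1))
        (by unfold EcgAdj; omega) (by unfold VertLadder; omega),
      nullFun_add t k α β s (j := t + 1) (by omega),
      nullFun_add t k α β s (j := t) (by omega),
      nullFun_hor_sub t k α β s (j := t + 1) (by omega),
      nullFun_vert_sub t k α β s (j := k + 1) (by omega)]
    simp only [railFun_last _ _ hα, railFun_last _ _ hβ]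
    linear_combination α * β * hs + b * s * β * railFun_pred_last t hβ hα - b * s * r₂ * α * hβ
  · rw [sum_ecgWeight_mul d₁ r₁ d₂ r₂ b (nullFun t k α β s)
        (i := 2 * t + 2 * k + 7 - 0) (a := 2 * t + 2 * k + 7 - 1) (c := k + 2 + 0)
        (e := 0)
        (by omega) (by omega) (by omega) (by omega) (by omega)
        (by omega) (by omega) (by omega) (by omega) (by omega) (by unfold EcgAdj; omega),
      ecgWeight_self_hor (t := t) (k := k) (i := 2 * t + 2 * k + 7 - 0)
        (by unfold HorCorner; omega),
      ecgWeight_hor_rail (t := t) (k := k) (i := 2 * t + 2 * k + 7 - 0) (j := 2 * t + 2 * k + 7 - 1)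
        (by unfold EcgAdj; omega) (by omega) (by unfold VertLadder; omega)
        (by unfold VertLadder; omega) (by omega),
      ecgWeight_hor_end (t := t) (k := k) (i := 2 * t + 2 * k + 7 - 0) (j := k + 2 + 0)
        (by unfold EcgAdj; omega) (by omega) (by unfold VertLadder; omega)
        (by unfold VertLadder; omega) (by omega) (by unfold HorCorner; omega),
      ecgWeight_conn (t := t) (k := k) (i := 2 * t + 2 * k + 7 - 0) (j := 0)
        (by unfold EcgAdj; omega) (by unfold VertLadder; omega),
      nullFun_hor_sub t k α β s (j := 0) (by omega),
      nullFun_hor_sub t k α β s (j := 1) (by omega),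
      nullFun_add t k α β s (j := 0) (by omega),
      nullFun_of_le t k α β s (j := 0) (by omega)]
    simp only [railFun_zero]
    linear_combination hs + b * s * railFun_one β α t
  · rw [sum_ecgWeight_mul d₁ r₁ d₂ r₂ b (nullFun t k α β s)
        (i := 2 * t + 2 * k + 7 - (t + 1)) (a := 2 * t + 2 * k + 7 - t) (c := k + 2 + (t + 1))
        (e := t + 2 * k + 5 - 0)
        (by omega) (by omega) (by omega) (by omega) (by omega)
        (by omega) (by omega) (by omega) (by omega) (by omega) (by unfold EcgAdj; omega),
      ecgWeight_self_hor (t := t) (k := k) (i := 2 * t + 2 * k + 7 - (t + 1))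
        (by unfold HorCorner; omega),
      ecgWeight_hor_rail (t := t) (k := k) (i := 2 * t + 2 * k + 7 - (t + 1)) (j := 2 * t + 2 * k + 7 - t)
        (by unfold EcgAdj; omega) (by omega) (by unfold VertLadder; omega)
        (by unfold VertLadder; omega) (by omega),
      ecgWeight_hor_end (t := t) (k := k) (i := 2 * t + 2 * k + 7 - (t + 1)) (j := k + 2 + (t + 1))
        (by unfold EcgAdj; omega) (by omega) (by unfold VertLadder; omega)
        (by unfold VertLadder; omega) (by omega) (by unfold HorCorner; omega),
      ecgWeight_conn (t := t) (k := k) (i := 2 * t + 2 * k + 7 - (t + 1)) (j := t + 2 * k + 5 - 0)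
        (by unfold EcgAdj; omega) (by unfold VertLadder; omega),
      nullFun_hor_sub t k α β s (j := t + 1) (by omega),
      nullFun_hor_sub t k α β s (j := t) (by omega),
      nullFun_add t k α β s (j := t + 1) (by omega),
      nullFun_vert_sub t k α β s (j := 0) (by omega)]
    simp only [railFun_zero, railFun_last _ _ hβ]
    linear_combination α * hs + b * s * railFun_pred_last t hβ hα
  · rw [sum_ecgWeight_mul d₁ r₁ d₂ r₂ b (nullFun t k α β s)
        (i := k + 2 + (j + 1)) (a := k + 2 + j) (c := k + 2 + (j + 2))
        (e := 2 * t + 2 * k + 7 - (j + 1))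
        (by omega) (by omega) (by omega) (by omega) (by omega)
        (by omega) (by omega) (by omega) (by omega) (by omega) (by unfold EcgAdj; omega),
      ecgWeight_self (t := t) (k := k) (i := k + 2 + (j + 1))
        (by unfold VertCorner; omega) (by unfold HorCorner; omega),
      ecgWeight_hor_rail (t := t) (k := k) (i := k + 2 + (j + 1)) (j := k + 2 + j)
        (by unfold EcgAdj; omega) (by omega) (by unfold VertLadder; omega)
        (by unfold VertLadder; omega) (by omega),
      ecgWeight_hor_rail (t := t) (k := k) (i := k + 2 + (j + 1)) (j := k + 2 + (j + 2))
        (by unfold EcgAdj; omega) (by omega) (by unfold VertLadder; omega)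
        (by unfold VertLadder; omega) (by omega),
      ecgWeight_hor_rung (t := t) (k := k) (i := k + 2 + (j + 1)) (j := 2 * t + 2 * k + 7 - (j + 1))
        (by unfold EcgAdj; omega) (by omega) (by unfold VertLadder; omega)
        (by unfold VertLadder; omega) (by omega) (by unfold HorCorner; omega),
      nullFun_add t k α β s (j := j + 1) (by omega),
      nullFun_add t k α β s (j := j) (by omega),
      nullFun_add t k α β s (j := j + 2) (by omega),
      nullFun_hor_sub t k α β s (j := j + 1) (by omega)]
    linear_combination b * s * β * (((t : ℝ) + 1) / 2) * railFun_add_two α t j hβ +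
        b * ((t : ℝ) + 1) * s * railFun β α t (j + 1) * hβ
  · rw [sum_ecgWeight_mul d₁ r₁ d₂ r₂ b (nullFun t k α β s)
        (i := 2 * t + 2 * k + 7 - (j + 1)) (a := 2 * t + 2 * k + 7 - j) (c := 2 * t + 2 * k + 7 - (j + 2))
        (e := k + 2 + (j + 1))
        (by omega) (by omega) (by omega) (by omega) (by omega)
        (by omega) (by omega) (by omega) (by omega) (by omega) (by unfold EcgAdj; omega),
      ecgWeight_self (t := t) (k := k) (i := 2 * t + 2 * k + 7 - (j + 1))
        (by unfold VertCorner; omega) (by unfold HorCorner; omega),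
      ecgWeight_hor_rail (t := t) (k := k) (i := 2 * t + 2 * k + 7 - (j + 1)) (j := 2 * t + 2 * k + 7 - j)
        (by unfold EcgAdj; omega) (by omega) (by unfold VertLadder; omega)
        (by unfold VertLadder; omega) (by omega),
      ecgWeight_hor_rail (t := t) (k := k) (i := 2 * t + 2 * k + 7 - (j + 1)) (j := 2 * t + 2 * k + 7 - (j + 2))
        (by unfold EcgAdj; omega) (by omega) (by unfold VertLadder; omega)
        (by unfold VertLadder; omega) (by omega),
      ecgWeight_hor_rung (t := t) (k := k) (i := 2 * t + 2 * k + 7 - (j + 1)) (j := k + 2 + (j + 1))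
        (by unfold EcgAdj; omega) (by omega) (by unfold VertLadder; omega)
        (by unfold VertLadder; omega) (by omega) (by unfold HorCorner; omega),
      nullFun_hor_sub t k α β s (j := j + 1) (by omega),
      nullFun_hor_sub t k α β s (j := j) (by omega),
      nullFun_hor_sub t k α β s (j := j + 2) (by omega),
      nullFun_add t k α β s (j := j + 1) (by omega)]
    linear_combination b * s * (((t : ℝ) + 1) / 2) * railFun_add_two α t j hβ

/-- The null vector `nullFun` on the vertices of `ECG t k`. -/
def nullVec (t k : ℕ) (α β s : ℝ) (u : ZMod (2 * t + 2 * k + 8)) : ℝ :=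
  nullFun t k α β s u.val

theorem ecgMatrix_mulVec_nullVec {t k : ℕ} {d₁ r₁ d₂ r₂ b α β s : ℝ}
    (hα : α ^ 2 = 1) (hβ : β ^ 2 = 1)
    (hs₁ : s + d₁ + α * (r₁ + ((k : ℝ) + 1) / 2) - α * (1 - β * α ^ (k + 1)) / 2 = 0)
    (hs₂ : 1 + b * s * (d₂ + β * (r₂ + ((t : ℝ) + 1) / 2) - β * (1 - α * β ^ (t + 1)) / 2) = 0) :
    (ecgMatrix t k d₁ r₁ d₂ r₂ b).mulVec (nullVec t k α β s) = 0 := by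
  ext u
  refine (sum_zmod_val (n := 2 * t + 2 * k + 8) fun j =>
    ecgWeight t k d₁ r₁ d₂ r₂ b u.val j * nullFun t k α β s j).trans ?_
  by_cases hl : VertLadder t k u.val
  · exact sum_ecgWeight_mul_nullFun_vert _ _ hα hβ hs₁ (ZMod.val_lt u) hl
  · exact sum_ecgWeight_mul_nullFun_hor _ _ hα hβ hs₂ (ZMod.val_lt u) hl

section

variable (t k : ℕ) (α β s : ℝ)

theorem nullVec_zero : nullVec t k α β s (0 : ℕ) = 1 := by
  rw [nullVec, ZMod.val_cast_of_lt (by omega), nullFun_of_le (j := 0) _ _ _ _ _ (by omega),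
    railFun_zero]

theorem nullVec_vert_last : nullVec t k α β s (t + 2 * k + 5 : ℕ) = α := by
  rw [nullVec, ZMod.val_cast_of_lt (by omega),
    show t + 2 * k + 5 = t + 2 * k + 5 - 0 by omega,
    nullFun_vert_sub (j := 0) _ _ _ _ _ (by omega), railFun_zero, mul_one]

theorem nullVec_hor_last : nullVec t k α β s (2 * t + 2 * k + 7 : ℕ) = s := by
  rw [nullVec, ZMod.val_cast_of_lt (by omega),
    show 2 * t + 2 * k + 7 = 2 * t + 2 * k + 7 - 0 by omega,
    nullFun_hor_sub (j := 0) _ _ _ _ _ (by omega), railFun_zero, mul_one]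

theorem nullVec_hor_first : nullVec t k α β s (k + 2 : ℕ) = β * s := by
  rw [nullVec, ZMod.val_cast_of_lt (by omega), show k + 2 = k + 2 + 0 by omega,
    nullFun_add (j := 0) _ _ _ _ _ (by omega), railFun_zero, mul_one]

variable {α β}

theorem nullVec_vert_first_end (hα : α ^ 2 = 1) : nullVec t k α β s (k + 1 : ℕ) = β := by
  rw [nullVec, ZMod.val_cast_of_lt (by omega), nullFun_of_le _ _ _ _ _ le_rfl,
    railFun_last _ _ hα]

theorem nullVec_vert_second_start (hα : α ^ 2 = 1) :
    nullVec t k α β s (t + k + 4 : ℕ) = α * β := by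
  rw [nullVec, ZMod.val_cast_of_lt (by omega),
    show t + k + 4 = t + 2 * k + 5 - (k + 1) by omega,
    nullFun_vert_sub _ _ _ _ _ le_rfl, railFun_last _ _ hα]

theorem nullVec_hor_first_end (hβ : β ^ 2 = 1) :
    nullVec t k α β s (t + k + 3 : ℕ) = β * s * α := by
  rw [nullVec, ZMod.val_cast_of_lt (by omega), show t + k + 3 = k + 2 + (t + 1) by omega,
    nullFun_add _ _ _ _ _ le_rfl, railFun_last _ _ hβ]

theorem nullVec_hor_second_start (hβ : β ^ 2 = 1) :
    nullVec t k α β s (t + 2 * k + 6 : ℕ) = s * α := by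
  rw [nullVec, ZMod.val_cast_of_lt (by omega),
    show t + 2 * k + 6 = 2 * t + 2 * k + 7 - (t + 1) by omega,
    nullFun_hor_sub _ _ _ _ _ le_rfl, railFun_last _ _ hβ]

end

/-- The combination of the four null vectors attached to the sign pairs `(1, 1)`, `(1, -1)`,
`(-1, 1)`, `(-1, -1)`. -/
def nullComb (t k : ℕ) (S c : Fin 4 → ℝ) (u : ZMod (2 * t + 2 * k + 8)) : ℝ :=
  c 0 * nullVec t k 1 1 (S 0) u + c 1 * nullVec t k 1 (-1) (S 1) u +
    c 2 * nullVec t k (-1) 1 (S 2) u + c 3 * nullVec t k (-1) (-1) (S 3) u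

theorem nullComb_eq_zero_of_corners {t k : ℕ} {S c : Fin 4 → ℝ}
    (h₀ : nullComb t k S c (0 : ℕ) = 0) (h₁ : nullComb t k S c (t + 2 * k + 5 : ℕ) = 0)
    (h₂ : nullComb t k S c (k + 1 : ℕ) = 0) (h₃ : nullComb t k S c (t + k + 4 : ℕ) = 0) :
    c = 0 := by
  have e : ((-1 : ℝ)) ^ 2 = 1 := by norm_num
  simp only [nullComb, nullVec_zero, nullVec_vert_last,
    nullVec_vert_first_end _ _ _ (one_pow 2), nullVec_vert_first_end _ _ _ e,
    nullVec_vert_second_start _ _ _ (one_pow 2), nullVec_vert_second_start _ _ _ e]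
    at h₀ h₁ h₂ h₃
  ext i
  fin_cases i <;> simp only [Pi.zero_apply, Fin.reduceFinMk, Fin.zero_eta, Fin.mk_one] <;> linarith

/-- The linear conditions on a ladder weighting for the sign pair `(α, β)` to carry a null vector
with ratio `s` between the two ladders. -/
def NullCondition (t k : ℕ) (d₁ r₁ d₂ r₂ b α β s : ℝ) : Prop :=
  s + d₁ + α * (r₁ + ((k : ℝ) + 1) / 2) - α * (1 - β * α ^ (k + 1)) / 2 = 0 ∧
    1 + b * s * (d₂ + β * (r₂ + ((t : ℝ) + 1) / 2) - β * (1 - α * β ^ (t + 1)) / 2) = 0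

/-- `NullCondition` for all four sign pairs. -/
structure NullConditions (t k : ℕ) (d₁ r₁ d₂ r₂ b : ℝ) (S : Fin 4 → ℝ) : Prop where
  pp : NullCondition t k d₁ r₁ d₂ r₂ b 1 1 (S 0)
  pm : NullCondition t k d₁ r₁ d₂ r₂ b 1 (-1) (S 1)
  mp : NullCondition t k d₁ r₁ d₂ r₂ b (-1) 1 (S 2)
  mm : NullCondition t k d₁ r₁ d₂ r₂ b (-1) (-1) (S 3)

section

variable {t k : ℕ} {d₁ r₁ d₂ r₂ b : ℝ} {S : Fin 4 → ℝ}

theorem ecgMatrix_mulVec_nullComb (h : NullConditions t k d₁ r₁ d₂ r₂ b S) (c : Fin 4 → ℝ) :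
    (ecgMatrix t k d₁ r₁ d₂ r₂ b).mulVec (nullComb t k S c) = 0 := by
  have e : ((-1 : ℝ)) ^ 2 = 1 := by norm_num
  have hc : nullComb t k S c = c 0 • nullVec t k 1 1 (S 0) + c 1 • nullVec t k 1 (-1) (S 1) +
      c 2 • nullVec t k (-1) 1 (S 2) + c 3 • nullVec t k (-1) (-1) (S 3) := by
    ext u
    simp [nullComb]
  rw [hc]
  simp only [Matrix.mulVec_add, Matrix.mulVec_smul,
    ecgMatrix_mulVec_nullVec (one_pow 2) (one_pow 2) h.pp.1 h.pp.2,
    ecgMatrix_mulVec_nullVec (one_pow 2) e h.pm.1 h.pm.2,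
    ecgMatrix_mulVec_nullVec e (one_pow 2) h.mp.1 h.mp.2,
    ecgMatrix_mulVec_nullVec e e h.mm.1 h.mm.2, smul_zero, add_zero]

theorem four_le_card_sub_rank (h : NullConditions t k d₁ r₁ d₂ r₂ b S) :
    4 ≤ Fintype.card (ZMod (2 * t + 2 * k + 8)) - (ecgMatrix t k d₁ r₁ d₂ r₂ b).rank := by
  rw [card_sub_rank_eq_finrank_ker]
  let φ : (Fin 4 → ℝ) →ₗ[ℝ] LinearMap.ker (ecgMatrix t k d₁ r₁ d₂ r₂ b).mulVecLin :=
    { toFun := fun c => ⟨nullComb t k S c, ecgMatrix_mulVec_nullComb h c⟩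
      map_add' := fun c c' => by
        ext u
        simp only [nullComb, Pi.add_apply, Submodule.coe_add]
        ring
      map_smul' := fun a c => by
        ext u
        simp only [nullComb, Pi.smul_apply, smul_eq_mul, Submodule.coe_smul, RingHom.id_apply]
        ring }
  have hφ : Function.Injective φ := by
    rw [← LinearMap.ker_eq_bot, LinearMap.ker_eq_bot']
    intro c hc
    have hc' : nullComb t k S c = 0 := congrArg Subtype.val hc
    exact nullComb_eq_zero_of_corners (congrFun hc' _) (congrFun hc' _) (congrFun hc' _)
      (congrFun hc' _)
  simpa using LinearMap.finrank_le_finrank_of_injective hφ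

theorem exists_eq_nullComb (h : NullConditions t k d₁ r₁ d₂ r₂ b S) (hr₁ : r₁ ≠ 0) (hr₂ : r₂ ≠ 0)
    (hb : b ≠ 0) (h₀₁ : S 0 ≠ S 1) (h₂₃ : S 2 ≠ S 3) {x : ZMod (2 * t + 2 * k + 8) → ℝ}
    (hx : (ecgMatrix t k d₁ r₁ d₂ r₂ b).mulVec x = 0) : ∃ c, x = nullComb t k S c := by
  have e : ((-1 : ℝ)) ^ 2 = 1 := by norm_num
  have e₀₁ : S 1 - S 0 ≠ 0 := sub_ne_zero.2 h₀₁.symm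
  have e₂₃ : S 3 - S 2 ≠ 0 := sub_ne_zero.2 h₂₃.symm
  obtain ⟨c₁, hc₁⟩ : ∃ c, c * (S 1 - S 0) =
      (x (2 * t + 2 * k + 7 : ℕ) + x (t + 2 * k + 6 : ℕ)) / 2 -
        S 0 * ((x (0 : ℕ) + x (t + 2 * k + 5 : ℕ)) / 2) := ⟨_, div_mul_cancel₀ _ e₀₁⟩
  obtain ⟨c₃, hc₃⟩ : ∃ c, c * (S 3 - S 2) =
      (x (2 * t + 2 * k + 7 : ℕ) - x (t + 2 * k + 6 : ℕ)) / 2 -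
        S 2 * ((x (0 : ℕ) - x (t + 2 * k + 5 : ℕ)) / 2) := ⟨_, div_mul_cancel₀ _ e₂₃⟩
  let c : Fin 4 → ℝ := ![(x (0 : ℕ) + x (t + 2 * k + 5 : ℕ)) / 2 - c₁, c₁,
    (x (0 : ℕ) - x (t + 2 * k + 5 : ℕ)) / 2 - c₃, c₃]
  have h0 : c 0 = (x (0 : ℕ) + x (t + 2 * k + 5 : ℕ)) / 2 - c₁ := rfl
  have h1 : c 1 = c₁ := rfl
  have h2 : c 2 = (x (0 : ℕ) - x (t + 2 * k + 5 : ℕ)) / 2 - c₃ := rfl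
  have h3 : c 3 = c₃ := rfl
  refine ⟨c, ?_⟩
  rw [← sub_eq_zero]
  have hker : (ecgMatrix t k d₁ r₁ d₂ r₂ b).mulVec (x - nullComb t k S c) = 0 := by
    rw [Matrix.mulVec_sub, hx, ecgMatrix_mulVec_nullComb h, sub_zero]
  ext v
  refine (ecgForcingSet_isZeroForcingSet t k v).apply_eq_zero (ecgMatrix_sMat hr₁ hr₂ hb) hker ?_
  rintro w (rfl | rfl | rfl | rfl) <;> rw [Pi.sub_apply, nullComb, h0, h1, h2, h3]
  · simp only [nullVec_zero]
    ring
  · simp only [nullVec_vert_last]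
    ring
  · simp only [nullVec_hor_second_start _ _ _ (one_pow 2), nullVec_hor_second_start _ _ _ e]
    linear_combination hc₃ - hc₁
  · simp only [nullVec_hor_last]
    linear_combination - hc₁ - hc₃

end

/-! ### The Strong Arnold Property -/

/-- The coefficients expressing the values of a null vector on the ends of the horizontal ladder
by its values on the ends of the vertical ladder. -/
def transfer (S : Fin 4 → ℝ) : Fin 4 → ℝ :=
  ![S 0 + S 1 + S 2 + S 3, S 0 + S 1 - S 2 - S 3, S 0 - S 1 + S 2 - S 3, S 0 - S 1 - S 2 + S 3]

theorem nullComb_hor_corners (t k : ℕ) (S c : Fin 4 → ℝ) :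
    (4 * nullComb t k S c (2 * t + 2 * k + 7 : ℕ) =
      transfer S 0 * nullComb t k S c (0 : ℕ) +
        transfer S 1 * nullComb t k S c (t + 2 * k + 5 : ℕ) +
        transfer S 2 * nullComb t k S c (k + 1 : ℕ) +
        transfer S 3 * nullComb t k S c (t + k + 4 : ℕ)) ∧
    (4 * nullComb t k S c (t + 2 * k + 6 : ℕ) =
      transfer S 1 * nullComb t k S c (0 : ℕ) +
        transfer S 0 * nullComb t k S c (t + 2 * k + 5 : ℕ) +
        transfer S 3 * nullComb t k S c (k + 1 : ℕ) +
        transfer S 2 * nullComb t k S c (t + k + 4 : ℕ)) ∧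
    (4 * nullComb t k S c (k + 2 : ℕ) =
      transfer S 2 * nullComb t k S c (0 : ℕ) +
        transfer S 3 * nullComb t k S c (t + 2 * k + 5 : ℕ) +
        transfer S 0 * nullComb t k S c (k + 1 : ℕ) +
        transfer S 1 * nullComb t k S c (t + k + 4 : ℕ)) ∧
    (4 * nullComb t k S c (t + k + 3 : ℕ) =
      transfer S 3 * nullComb t k S c (0 : ℕ) +
        transfer S 2 * nullComb t k S c (t + 2 * k + 5 : ℕ) +
        transfer S 1 * nullComb t k S c (k + 1 : ℕ) +
        transfer S 0 * nullComb t k S c (t + k + 4 : ℕ)) := by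
  have e : ((-1 : ℝ)) ^ 2 = 1 := by norm_num
  have h0 : transfer S 0 = S 0 + S 1 + S 2 + S 3 := rfl
  have h1 : transfer S 1 = S 0 + S 1 - S 2 - S 3 := rfl
  have h2 : transfer S 2 = S 0 - S 1 + S 2 - S 3 := rfl
  have h3 : transfer S 3 = S 0 - S 1 - S 2 + S 3 := rfl
  simp only [nullComb, nullVec_zero, nullVec_vert_last, nullVec_hor_last, nullVec_hor_first,
    nullVec_vert_first_end _ _ _ (one_pow 2), nullVec_vert_first_end _ _ _ e,
    nullVec_vert_second_start _ _ _ (one_pow 2), nullVec_vert_second_start _ _ _ e,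
    nullVec_hor_first_end _ _ _ (one_pow 2), nullVec_hor_first_end _ _ _ e,
    nullVec_hor_second_start _ _ _ (one_pow 2), nullVec_hor_second_start _ _ _ e,
    h0, h1, h2, h3]
  refine ⟨?_, ?_, ?_, ?_⟩ <;> ring

/-- The cases in which the edge conditions on the eight ladder ends force a matrix whose columns
are null vectors to vanish on the ends of the vertical ladder. -/
def TransferNondegenerate (T : Fin 4 → ℝ) : Prop :=
  (T 2 = 0 ∧ T 3 ≠ 0 ∧ (T 1 ≠ 0 ∨ T 0 ^ 4 ≠ T 3 ^ 4)) ∨ (T 3 = 0 ∧ T 2 ≠ 0 ∧ T 1 ≠ 0)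

theorem corner_entries_eq_zero {ι : Type*} {X : ι → ι → ℝ} (hX : ∀ u v, X u v = X v u)
    {T : Fin 4 → ℝ} (hT : TransferNondegenerate T) {p p' q q' r r' s s' : ι}
    (hr : ∀ v, 4 * X r v = T 0 * X p v + T 1 * X p' v + T 2 * X q v + T 3 * X q' v)
    (hr' : ∀ v, 4 * X r' v = T 1 * X p v + T 0 * X p' v + T 3 * X q v + T 2 * X q' v)
    (hs : ∀ v, 4 * X s v = T 2 * X p v + T 3 * X p' v + T 0 * X q v + T 1 * X q' v)
    (hs' : ∀ v, 4 * X s' v = T 3 * X p v + T 2 * X p' v + T 1 * X q v + T 0 * X q' v)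
    (hdiag : ∀ v, X v v = 0) (hpp : X p p' = 0) (hqq : X q q' = 0) (hpr : X r p = 0)
    (hpr' : X r' p' = 0) (hqs : X s q = 0) (hqs' : X s' q' = 0) (hrs : X s r = 0)
    (hrs' : X s' r' = 0) : X p q = 0 ∧ X p q' = 0 ∧ X p' q = 0 ∧ X p' q' = 0 := by
  have gr := hr r
  have gr' := hr' r'
  have gs := hs s
  have gs' := hs' s'
  have gsr := hs r
  have gsr' := hs' r'
  have hpp' := (hX p' p).trans hpp
  have hqq' := (hX q' q).trans hqq
  rw [hX p r, hX p' r, hX q r, hX q' r] at gr gsr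
  rw [hX p r', hX p' r', hX q r', hX q' r'] at gr' gsr'
  rw [hX p s, hX p' s, hX q s, hX q' s] at gs
  rw [hX p s', hX p' s', hX q s', hX q' s'] at gs'
  have r1 := hr p
  have r2 := hr p'
  have r3 := hr q
  have r4 := hr q'
  have r1' := hr' p
  have r2' := hr' p'
  have r3' := hr' q
  have r4' := hr' q'
  have s1 := hs p
  have s2 := hs p'
  have s3 := hs q
  have s4 := hs q'
  have s1' := hs' p
  have s2' := hs' p'
  have s3' := hs' q
  have s4' := hs' q'
  simp only [hdiag, hpp, hqq, hpp', hqq', hpr, hpr', hqs, hqs', hrs, hrs', hX q p, hX q' p,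
    hX q p', hX q' p', mul_zero, zero_add, add_zero] at *
  have e₁ : T 2 * X p q + T 3 * X p q' = 0 := by linear_combination - r1
  have e₂ : T 3 * X p' q + T 2 * X p' q' = 0 := by linear_combination - r2'
  have e₃ : T 2 * X p q + T 3 * X p' q = 0 := by linear_combination - s3
  have e₄ : T 3 * X p q' + T 2 * X p' q' = 0 := by linear_combination - s4'
  have e₅ : T 1 * (T 2 * X p' q + T 3 * X p' q') = 0 := by
    linear_combination (-4 * gr - T 1 * r2 - T 2 * r3 - T 3 * r4 - T 0 * e₁) / 2
  have e₆ : T 1 * (T 3 * X p q + T 2 * X p q') = 0 := by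
    linear_combination (-4 * gr' - T 1 * r1' - T 3 * r3' - T 2 * r4' - T 0 * e₂) / 2
  have e₇ : T 1 * (T 2 * X p q' + T 3 * X p' q') = 0 := by
    linear_combination (-4 * gs - T 2 * s1 - T 3 * s2 - T 1 * s4 - T 0 * e₃) / 2
  have e₈ : T 0 * (T 0 * X p q + T 1 * X p' q) + T 1 * (T 0 * X p q' + T 1 * X p' q') +
      T 3 * (T 2 * X p' q + T 3 * X p' q') = 0 := by
    linear_combination -4 * gsr - T 3 * r2 - T 0 * r3 - T 1 * r4
  have e₉ : T 0 * (T 0 * X p' q' + T 1 * X p q') + T 1 * (T 0 * X p' q + T 1 * X p q) +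
      T 3 * (T 2 * X p q' + T 3 * X p q) = 0 := by
    linear_combination -4 * gsr' - T 3 * r1' - T 1 * r3' - T 0 * r4'
  rcases hT with ⟨h2, h3, h⟩ | ⟨h3, h2, h1⟩
  · have hb : X p q' = 0 := by simpa [h2, h3] using e₁
    have hc : X p' q = 0 := by simpa [h2, h3] using e₂
    by_cases h1 : T 1 = 0
    · have h0 : T 0 ^ 4 - T 3 ^ 4 ≠ 0 := sub_ne_zero.2 (h.resolve_left (not_not.2 h1))
      rw [h1, h2] at e₈ e₉
      refine ⟨(mul_eq_zero.1 (?_ : (T 0 ^ 4 - T 3 ^ 4) * X p q = 0)).resolve_left h0, hb, hc,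
        (mul_eq_zero.1 (?_ : (T 0 ^ 4 - T 3 ^ 4) * X p' q' = 0)).resolve_left h0⟩
      · linear_combination T 0 ^ 2 * e₈ - T 3 ^ 2 * e₉
      · linear_combination T 0 ^ 2 * e₉ - T 3 ^ 2 * e₈
    · exact ⟨by simpa [h1, h2, h3] using e₆, hb, hc, by simpa [h1, h2, h3] using e₅⟩
  · exact ⟨by simpa [h2, h3] using e₁, by simpa [h1, h2, h3] using e₇,
      by simpa [h1, h2, h3] using e₅, by simpa [h2, h3] using e₂⟩

theorem ecgMatrix_hasSAP {t k : ℕ} {d₁ r₁ d₂ r₂ b : ℝ} {S : Fin 4 → ℝ}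
    (h : NullConditions t k d₁ r₁ d₂ r₂ b S) (hr₁ : r₁ ≠ 0) (hr₂ : r₂ ≠ 0) (hb : b ≠ 0)
    (h₀₁ : S 0 ≠ S 1) (h₂₃ : S 2 ≠ S 3) (hT : TransferNondegenerate (transfer S)) :
    HasSAP (ecgMatrix t k d₁ r₁ d₂ r₂ b) := by
  intro X hX hAX hAhX hIhX
  have hsymm : ∀ u v, X u v = X v u := fun u v => hX.apply v u
  have hdiag : ∀ v, X v v = 0 := fun v => by simpa using congrFun (congrFun hIhX v) v
  have hedge : ∀ i j : ℕ, i < 2 * t + 2 * k + 8 → j < 2 * t + 2 * k + 8 → i ≠ j →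
      EcgAdj t k i j → X (i : ℕ) (j : ℕ) = 0 := by
    intro i j hi hj hij hadj
    have hA : ecgMatrix t k d₁ r₁ d₂ r₂ b (i : ℕ) (j : ℕ) ≠ 0 := by
      rw [ecgMatrix, Matrix.of_apply, ZMod.val_cast_of_lt hi, ZMod.val_cast_of_lt hj]
      exact (ecgWeight_ne_zero_iff hr₁ hr₂ hb hij).2 hadj
    exact (mul_eq_zero.1 (congrFun (congrFun hAhX (i : ℕ)) (j : ℕ))).resolve_left hA
  choose c hc using fun v => exists_eq_nullComb h hr₁ hr₂ hb h₀₁ h₂₃ (x := fun u => X u v)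
    (funext fun u => congrFun (congrFun hAX u) v)
  have hv : ∀ u v, X u v = nullComb t k S (c v) u := fun u v => congrFun (hc v) u
  have hrel := fun v => nullComb_hor_corners t k S (c v)
  simp only [← hv] at hrel
  obtain ⟨z₁, z₂, z₃, z₄⟩ := corner_entries_eq_zero hsymm hT (fun v => (hrel v).1)
    (fun v => (hrel v).2.1) (fun v => (hrel v).2.2.1) (fun v => (hrel v).2.2.2) hdiag
    (hedge _ _ (by omega) (by omega) (by omega) (by unfold EcgAdj; omega))
    (hedge _ _ (by omega) (by omega) (by omega) (by unfold EcgAdj; omega))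
    (hedge _ _ (by omega) (by omega) (by omega) (by unfold EcgAdj; omega))
    (hedge _ _ (by omega) (by omega) (by omega) (by unfold EcgAdj; omega))
    (hedge _ _ (by omega) (by omega) (by omega) (by unfold EcgAdj; omega))
    (hedge _ _ (by omega) (by omega) (by omega) (by unfold EcgAdj; omega))
    (hedge _ _ (by omega) (by omega) (by omega) (by unfold EcgAdj; omega))
    (hedge _ _ (by omega) (by omega) (by omega) (by unfold EcgAdj; omega))
  have y₁ : X (0 : ℕ) (t + 2 * k + 5 : ℕ) = 0 :=
    hedge _ _ (by omega) (by omega) (by omega) (by unfold EcgAdj; omega)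
  have y₂ : X (k + 1 : ℕ) (t + k + 4 : ℕ) = 0 :=
    hedge _ _ (by omega) (by omega) (by omega) (by unfold EcgAdj; omega)
  have hzero : ∀ v, X (0 : ℕ) v = 0 → X (t + 2 * k + 5 : ℕ) v = 0 → X (k + 1 : ℕ) v = 0 →
      X (t + k + 4 : ℕ) v = 0 → ∀ u, X u v = 0 := by
    intro v h₀ h₁ h₂ h₃ u
    rw [hv] at h₀ h₁ h₂ h₃ ⊢
    rw [nullComb_eq_zero_of_corners h₀ h₁ h₂ h₃]
    simp [nullComb]
  have x₀ := hzero _ (hdiag _) ((hsymm _ _).trans y₁) ((hsymm _ _).trans z₁)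
    ((hsymm _ _).trans z₂)
  have x₁ := hzero _ y₁ (hdiag _) ((hsymm _ _).trans z₃) ((hsymm _ _).trans z₄)
  have x₂ := hzero _ z₁ z₃ (hdiag _) ((hsymm _ _).trans y₂)
  have x₃ := hzero _ z₂ z₄ y₂ (hdiag _)
  ext u v
  exact hzero v ((hsymm _ _).trans (x₀ v)) ((hsymm _ _).trans (x₁ v)) ((hsymm _ _).trans (x₂ v))
    ((hsymm _ _).trans (x₃ v)) u

theorem ecg_parameters_of_nullConditions {t k : ℕ} {d₁ r₁ d₂ r₂ b : ℝ} {S : Fin 4 → ℝ}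
    (h : NullConditions t k d₁ r₁ d₂ r₂ b S) (hr₁ : r₁ ≠ 0) (hr₂ : r₂ ≠ 0) (hb : b ≠ 0)
    (h₀₁ : S 0 ≠ S 1) (h₂₃ : S 2 ≠ S 3) (hT : TransferNondegenerate (transfer S)) :
    xi (ECG t k) = 4 ∧ maxNullity ℝ (ECG t k) = 4 ∧ zfn (ECG t k) = 4 :=
  parameters_eq_of_matrix (ecgMatrix_sMat hr₁ hr₂ hb) (ecgMatrix_hasSAP h hr₁ hr₂ hb h₀₁ h₂₃ hT)
    (four_le_card_sub_rank h) (ecgForcingSet_isZeroForcingSet t k) (ecgForcingSet_ncard_le t k)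

theorem sub_half_ne_zero {u : ℝ} {m : ℕ} (a c : ℕ) (hu : u * (2 * c) = a)
    (h : a ≠ c * (m + 1)) : u - ((m : ℝ) + 1) / 2 ≠ 0 := by
  intro h0
  apply h
  have : (a : ℝ) = c * (m + 1) := by linear_combination 2 * (c : ℝ) * h0 - hu
  exact_mod_cast this

theorem stmt10 (t k : ℕ) :
    xi (ECG t k) = 4 ∧ maxNullity ℝ (ECG t k) = 4 ∧ zfn (ECG t k) = 4 := by
  rcases Nat.even_or_odd k with hk | hk <;> rcases Nat.even_or_odd t with ht | ht <;>
    have ek := hk.add_one.neg_one_pow (α := ℝ) <;> have et := ht.add_one.neg_one_pow (α := ℝ) <;>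
    obtain ⟨m, hm⟩ := hk <;> obtain ⟨m', hm'⟩ := ht
  · refine ecg_parameters_of_nullConditions (S := ![1, 2, -2, -1]) (d₁ := 0)
      (r₁ := -1 - ((k : ℝ) + 1) / 2) (d₂ := 0) (r₂ := 2 / 3 - ((t : ℝ) + 1) / 2)
      (b := -3 / 2) ⟨?_, ?_, ?_, ?_⟩ ?_ ?_ ?_ ?_ ?_ ?_
    iterate 4 (simp only [NullCondition, ek, et, one_pow, Matrix.cons_val]; norm_num)
    · have : (0 : ℝ) ≤ k := k.cast_nonneg
      exact ne_of_lt (by linarith)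
    · exact sub_half_ne_zero 4 3 (by norm_num) (by omega)
    · norm_num
    · norm_num
    · simp only [Matrix.cons_val]; norm_num
    · simp only [TransferNondegenerate, transfer, Matrix.cons_val]; norm_num
  · refine ecg_parameters_of_nullConditions (S := ![-2 / 3, 1 / 3, 1, 2]) (d₁ := -2 / 3)
      (r₁ := 4 / 3 - ((k : ℝ) + 1) / 2) (d₂ := -3 / 10) (r₂ := 9 / 10 - ((t : ℝ) + 1) / 2)
      (b := 5 / 2) ⟨?_, ?_, ?_, ?_⟩ ?_ ?_ ?_ ?_ ?_ ?_
    iterate 4 (simp only [NullCondition, ek, et, one_pow, Matrix.cons_val]; norm_num)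
    · exact sub_half_ne_zero 8 3 (by norm_num) (by omega)
    · exact sub_half_ne_zero 9 5 (by norm_num) (by omega)
    · norm_num
    · norm_num
    · simp only [Matrix.cons_val]; norm_num
    · simp only [TransferNondegenerate, transfer, Matrix.cons_val]; norm_num
  · refine ecg_parameters_of_nullConditions (S := ![-3 / 5, 2 / 5, 6 / 5, 1 / 5]) (d₁ := -3 / 10)
      (r₁ := 9 / 10 - ((k : ℝ) + 1) / 2) (d₂ := -2 / 3) (r₂ := 4 / 3 - ((t : ℝ) + 1) / 2)
      (b := 5 / 2) ⟨?_, ?_, ?_, ?_⟩ ?_ ?_ ?_ ?_ ?_ ?_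
    iterate 4 (simp only [NullCondition, ek, et, one_pow, Matrix.cons_val]; norm_num)
    · exact sub_half_ne_zero 9 5 (by norm_num) (by omega)
    · exact sub_half_ne_zero 8 3 (by norm_num) (by omega)
    · norm_num
    · norm_num
    · simp only [Matrix.cons_val]; norm_num
    · simp only [TransferNondegenerate, transfer, Matrix.cons_val]; norm_num
  · refine ecg_parameters_of_nullConditions (S := ![1, 2, 2, 1]) (d₁ := -3 / 2)
      (r₁ := 1 / 2 - ((k : ℝ) + 1) / 2) (d₂ := 3 / 2) (r₂ := 1 / 2 - ((t : ℝ) + 1) / 2)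
      (b := -1 / 2) ⟨?_, ?_, ?_, ?_⟩ ?_ ?_ ?_ ?_ ?_ ?_
    iterate 4 (simp only [NullCondition, ek, et, one_pow, Matrix.cons_val]; norm_num)
    · exact sub_half_ne_zero 1 1 (by norm_num) (by omega)
    · exact sub_half_ne_zero 1 1 (by norm_num) (by omega)
    · norm_num
    · norm_num
    · simp only [Matrix.cons_val]; norm_num
    · simp only [TransferNondegenerate, transfer, Matrix.cons_val]; norm_num

end Paper
end
end

section
/- Let G be the circulant graph Circ[n,S] for a nonempty S ⊆ {1,...,⌊n/2⌋}, and let m = max S. Then Z(G) ≤ 2m. -/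
open scoped Classical

noncomputable section

namespace Paper

variable {V : Type*}

/-- The first `2 * m` vertices force the whole circulant graph when `m` is the largest step. -/
lemma forced_natCast_circG {n m : ℕ} {S : Set ℕ} (hpos : 1 ≤ m) (hmn : m < n) (hm : m ∈ S)
    (hmax : ∀ s ∈ S, s ≤ m) (k : ℕ) :
    Forced (circG n S) (((↑) : ℕ → ZMod n) '' Set.Iio (2 * m)) (k : ZMod n) := by
  induction k using Nat.strong_induction_on with
  | _ k ih =>
    rcases lt_or_ge k (2 * m) with hk | hk
    · exact .init _ ⟨k, hk, rfl⟩
    have hkm : (k : ZMod n) = ((k - m : ℕ) : ZMod n) + (m : ZMod n) := by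
      rw [← Nat.cast_add, Nat.sub_add_cancel (by omega)]
    refine .force ((k - m : ℕ) : ZMod n) k (ih _ (by omega)) ?_ ?_
    · refine (SimpleGraph.fromRel_adj _ _ _).2 ⟨fun h => ?_, .inl ⟨m, hm, hkm⟩⟩
      rw [hkm, left_eq_add, ZMod.natCast_eq_zero_iff] at h
      exact absurd (Nat.le_of_dvd hpos h) (by omega)
    · intro x hx hxk
      rcases ((SimpleGraph.fromRel_adj _ _ _).1 hx).2 with ⟨s, hs, h⟩ | ⟨s, hs, h⟩
      · have hsm : s ≠ m := by
          rintro rfl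
          exact hxk (h.trans hkm.symm)
        have hle := hmax s hs
        rw [h, ← Nat.cast_add]
        exact ih _ (by omega)
      · have hle := hmax s hs
        have hx' : x = ((k - m - s : ℕ) : ZMod n) := by
          rw [Nat.cast_sub (by omega), h, add_sub_cancel_right]
        rw [hx']
        exact ih _ (by omega)

theorem stmt12 (n : ℕ) (hn : 3 ≤ n) (S : Set ℕ) (hS : S.Nonempty)
    (hSsub : S ⊆ Set.Icc 1 (n / 2)) (m : ℕ) (hm : m ∈ S) (hmax : ∀ s ∈ S, s ≤ m) :
    zfn (circG n S) ≤ 2 * m := by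
  have hm' := hSsub hm
  rw [Set.mem_Icc] at hm'
  have : NeZero n := ⟨by omega⟩
  have hZ : IsZeroForcingSet (circG n S) (((↑) : ℕ → ZMod n) '' Set.Iio (2 * m)) := fun v => by
    rw [← ZMod.natCast_zmod_val v]
    exact forced_natCast_circG hm'.1 (by omega) hm hmax _
  have hle : zfn (circG n S) ≤ (((↑) : ℕ → ZMod n) '' Set.Iio (2 * m)).ncard :=
    Nat.sInf_le ⟨_, rfl, hZ⟩
  refine hle.trans ((Set.ncard_image_le (Set.finite_Iio _)).trans ?_)
  rw [← Finset.coe_Iio, Set.ncard_coe_finset, Nat.card_Iio]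

end Paper
end
end

section
/- Let n > 9, let m = ⌈n/2⌉ − 1, and let H = Circ[n, {1,2,...,m} \ {m−1}]. Then Z(H) ≤ 2(m−1). -/
open scoped Classical

noncomputable section

namespace Paper

variable {V : Type*}

theorem circG_adj_natCast {n : ℕ} {S : Set ℕ} (hS : ∀ s ∈ S, s < n) {a b : ℕ}
    (ha : a < n) (hb : b < n) :
    (circG n S).Adj (a : ZMod n) (b : ZMod n) ↔
      a ≠ b ∧ ∃ s ∈ S, b = a + s ∨ b + n = a + s ∨ a = b + s ∨ a + n = b + s := by
  have cast_iff : ∀ {x y s : ℕ}, x < n → y < n → s < n →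
      ((y : ZMod n) = (x : ZMod n) + (s : ZMod n) ↔ y = x + s ∨ y + n = x + s) := by
    intro x y s hx hy hs
    rw [← Nat.cast_add, ZMod.natCast_eq_natCast_iff', Nat.mod_eq_of_lt hy]
    rcases lt_or_ge (x + s) n with h | h
    · rw [Nat.mod_eq_of_lt h]; omega
    · rw [Nat.mod_eq_sub_mod h, Nat.mod_eq_of_lt (by omega)]; omega
  have ne_iff : ((a : ZMod n) ≠ (b : ZMod n)) ↔ a ≠ b := by
    rw [Ne, ZMod.natCast_eq_natCast_iff', Nat.mod_eq_of_lt ha, Nat.mod_eq_of_lt hb]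
  rw [circG, SimpleGraph.fromRel_adj, ne_iff]
  refine and_congr_right fun _ => ⟨?_, ?_⟩
  · rintro (⟨s, hs, h⟩ | ⟨s, hs, h⟩)
    · have := (cast_iff ha hb (hS s hs)).1 h
      exact ⟨s, hs, by tauto⟩
    · have := (cast_iff hb ha (hS s hs)).1 h
      exact ⟨s, hs, by tauto⟩
  · rintro ⟨s, hs, h⟩
    have h₁ := cast_iff ha hb (hS s hs)
    have h₂ := cast_iff hb ha (hS s hs)
    rcases h with h | h | h | h
    · exact Or.inl ⟨s, hs, h₁.2 (Or.inl h)⟩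
    · exact Or.inl ⟨s, hs, h₁.2 (Or.inr h)⟩
    · exact Or.inr ⟨s, hs, h₂.2 (Or.inl h)⟩
    · exact Or.inr ⟨s, hs, h₂.2 (Or.inr h)⟩

theorem zfn_le_of_forced_range_sdiff {n : ℕ} [NeZero n] (G : SimpleGraph (ZMod n))
    (W : Finset ℕ) (hW : W ⊆ Finset.range n)
    (h : ∀ v < n, Forced G ((↑) '' ((Finset.range n \ W : Finset ℕ) : Set ℕ)) (v : ZMod n)) :
    zfn G ≤ n - W.card := by
  refine (Nat.sInf_le ⟨_, rfl, fun v => ?_⟩ : zfn G ≤ _).trans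
    ((Set.ncard_image_le (f := ((↑) : ℕ → ZMod n))
      (Finset.finite_toSet (Finset.range n \ W))).trans ?_)
  · simpa using h v.val (ZMod.val_lt v)
  · rw [Set.ncard_coe_finset, Finset.card_sdiff_of_subset hW, Finset.card_range]

theorem Forced.natCast_of_adj {n : ℕ} [NeZero n] {G : SimpleGraph (ZMod n)} {Z : Set (ZMod n)}
    {u w : ℕ} (hu : Forced G Z (u : ZMod n)) (huw : G.Adj (u : ZMod n) (w : ZMod n))
    (h : ∀ x < n, x ≠ w → G.Adj (u : ZMod n) (x : ZMod n) → Forced G Z (x : ZMod n)) :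
    Forced G Z (w : ZMod n) := by
  refine Forced.force _ _ hu huw fun x hx hxw => ?_
  have := h x.val (ZMod.val_lt x) (by rintro rfl; simp at hxw) (by simpa using hx)
  simpa using this

theorem circG_even_adj {k a b : ℕ} (hk : 5 ≤ k) (ha : a < 2 * k) (hb : b < 2 * k) :
    (circG (2 * k) (Set.Icc 1 (k - 1) \ {k - 2})).Adj (a : ZMod (2 * k)) (b : ZMod (2 * k)) ↔
      a ≠ b ∧ b ≠ a + k ∧ b ≠ a + k - 2 ∧ b ≠ a + k + 2 ∧
        a ≠ b + k ∧ a ≠ b + k - 2 ∧ a ≠ b + k + 2 := by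
  rw [circG_adj_natCast (by rintro s ⟨⟨_, _⟩, _⟩; omega) ha hb]
  simp only [Set.mem_sdiff, Set.mem_Icc, Set.mem_singleton_iff]
  constructor
  · rintro ⟨hab, s, hs, h⟩
    omega
  · intro h
    refine ⟨h.1, ?_⟩
    rcases lt_or_ge a b with hlt | hge
    · by_cases hd : b - a < k
      · exact ⟨b - a, by omega⟩
      · exact ⟨2 * k - (b - a), by omega⟩
    · by_cases hd : a - b < k
      · exact ⟨a - b, by omega⟩
      · exact ⟨2 * k - (a - b), by omega⟩

theorem circG_odd_adj {k a b : ℕ} (hk : 5 ≤ k) (ha : a < 2 * k + 1) (hb : b < 2 * k + 1) :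
    (circG (2 * k + 1) (Set.Icc 1 k \ {k - 1})).Adj
        (a : ZMod (2 * k + 1)) (b : ZMod (2 * k + 1)) ↔
      a ≠ b ∧ b ≠ a + k - 1 ∧ b ≠ a + k + 2 ∧ a ≠ b + k - 1 ∧ a ≠ b + k + 2 := by
  rw [circG_adj_natCast (by rintro s ⟨⟨_, _⟩, _⟩; omega) ha hb]
  simp only [Set.mem_sdiff, Set.mem_Icc, Set.mem_singleton_iff]
  constructor
  · rintro ⟨hab, s, hs, h⟩
    omega
  · intro h
    refine ⟨h.1, ?_⟩
    rcases lt_or_ge a b with hlt | hge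
    · by_cases hd : b - a ≤ k
      · exact ⟨b - a, by omega⟩
      · exact ⟨2 * k + 1 - (b - a), by omega⟩
    · by_cases hd : a - b ≤ k
      · exact ⟨a - b, by omega⟩
      · exact ⟨2 * k + 1 - (a - b), by omega⟩

theorem zfn_circG_even_le {k : ℕ} (hk : 5 ≤ k) :
    zfn (circG (2 * k) (Set.Icc 1 (k - 1) \ {k - 2})) ≤ 2 * k - 4 := by
  have : NeZero (2 * k) := ⟨by omega⟩
  set G := circG (2 * k) (Set.Icc 1 (k - 1) \ {k - 2}) with hG
  let W : Finset ℕ := {1, k - 2, k, k + 2}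
  have hcard : W.card = 4 := by
    rw [Finset.card_insert_of_notMem, Finset.card_insert_of_notMem,
      Finset.card_insert_of_notMem, Finset.card_singleton]
    all_goals simp only [Finset.mem_insert, Finset.mem_singleton]; omega
  rw [← hcard]
  refine zfn_le_of_forced_range_sdiff G W ?_ ?_
  · intro x hx
    simp only [W, Finset.mem_insert, Finset.mem_singleton] at hx
    simp only [Finset.mem_range]
    omega
  set Z : Set (ZMod (2 * k)) := (↑) '' ((Finset.range (2 * k) \ W : Finset ℕ) : Set ℕ)
  have blue : ∀ x < 2 * k, x ≠ 1 → x ≠ k - 2 → x ≠ k → x ≠ k + 2 →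
      Forced G Z (x : ZMod (2 * k)) := by
    intro x hx h₁ h₂ h₃ h₄
    refine Forced.init _ ⟨x, ?_, rfl⟩
    simp [W, hx, h₁, h₂, h₃, h₄]
  have adj {a b : ℕ} (ha : a < 2 * k) (hb : b < 2 * k) := circG_even_adj hk ha hb
  rw [← hG] at adj
  have f₁ : Forced G Z ((1 : ℕ) : ZMod (2 * k)) := by
    refine Forced.natCast_of_adj (u := 0) (blue 0 ?_ ?_ ?_ ?_ ?_)
      ((adj ?_ ?_).2 ?_) fun x hx hxw h => ?_
    on_goal 9 =>
      rw [adj (by omega) hx] at h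
      apply blue x hx
    all_goals omega
  have f₂ : Forced G Z ((k - 2 : ℕ) : ZMod (2 * k)) := by
    refine Forced.natCast_of_adj (u := 2) (blue 2 ?_ ?_ ?_ ?_ ?_)
      ((adj ?_ ?_).2 ?_) fun x hx hxw h => ?_
    on_goal 9 =>
      rw [adj (by omega) hx] at h
      by_cases h₁ : x = 1
      · exact h₁ ▸ f₁
      apply blue x hx
    all_goals omega
  have f₃ : Forced G Z (k : ZMod (2 * k)) := by
    have f₄ : Forced G Z ((4 : ℕ) : ZMod (2 * k)) := by
      by_cases h : 4 = k - 2
      · exact h ▸ f₂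
      · apply blue <;> omega
    refine Forced.natCast_of_adj (u := 4) f₄ ((adj ?_ ?_).2 ?_) fun x hx hxw h => ?_
    on_goal 4 =>
      rw [adj (by omega) hx] at h
      by_cases h₁ : x = 1
      · exact h₁ ▸ f₁
      by_cases h₂ : x = k - 2
      · exact h₂ ▸ f₂
      apply blue x hx
    all_goals omega
  have blue' : ∀ x < 2 * k, x ≠ k + 2 → Forced G Z (x : ZMod (2 * k)) := by
    intro x hx h₄
    by_cases h₁ : x = 1
    · exact h₁ ▸ f₁
    by_cases h₂ : x = k - 2
    · exact h₂ ▸ f₂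
    by_cases h₃ : x = k
    · exact h₃ ▸ f₃
    exact blue x hx h₁ h₂ h₃ h₄
  intro v hv
  by_cases h₄ : v = k + 2
  · subst h₄
    exact Forced.natCast_of_adj (u := k + 3) (blue' _ (by omega) (by omega))
      ((adj (by omega) (by omega)).2 (by omega)) fun x hx hxw _ => blue' x hx hxw
  · exact blue' v hv h₄

theorem zfn_circG_odd_le {k : ℕ} (hk : 5 ≤ k) :
    zfn (circG (2 * k + 1) (Set.Icc 1 k \ {k - 1})) ≤ 2 * k + 1 - 3 := by
  set G := circG (2 * k + 1) (Set.Icc 1 k \ {k - 1}) with hG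
  let W : Finset ℕ := {1, k - 1, k + 2}
  have hcard : W.card = 3 := by
    rw [Finset.card_insert_of_notMem, Finset.card_insert_of_notMem, Finset.card_singleton]
    all_goals simp only [Finset.mem_insert, Finset.mem_singleton]; omega
  rw [← hcard]
  refine zfn_le_of_forced_range_sdiff G W ?_ ?_
  · intro x hx
    simp only [W, Finset.mem_insert, Finset.mem_singleton] at hx
    simp only [Finset.mem_range]
    omega
  set Z : Set (ZMod (2 * k + 1)) := (↑) '' ((Finset.range (2 * k + 1) \ W : Finset ℕ) : Set ℕ)
  have blue : ∀ x < 2 * k + 1, x ≠ 1 → x ≠ k - 1 → x ≠ k + 2 →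
      Forced G Z (x : ZMod (2 * k + 1)) := by
    intro x hx h₁ h₂ h₃
    refine Forced.init _ ⟨x, ?_, rfl⟩
    simp [W, hx, h₁, h₂, h₃]
  have adj {a b : ℕ} (ha : a < 2 * k + 1) (hb : b < 2 * k + 1) := circG_odd_adj hk ha hb
  rw [← hG] at adj
  have f₁ : Forced G Z ((1 : ℕ) : ZMod (2 * k + 1)) := by
    refine Forced.natCast_of_adj (u := 0) (blue 0 ?_ ?_ ?_ ?_)
      ((adj ?_ ?_).2 ?_) fun x hx hxw h => ?_
    on_goal 8 =>
      rw [adj (by omega) hx] at h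
      apply blue x hx
    all_goals omega
  have f₂ : Forced G Z ((k + 2 : ℕ) : ZMod (2 * k + 1)) := by
    refine Forced.natCast_of_adj (u := 2 * k - 2) (blue _ ?_ ?_ ?_ ?_)
      ((adj ?_ ?_).2 ?_) fun x hx hxw h => ?_
    on_goal 8 =>
      rw [adj (by omega) hx] at h
      by_cases h₁ : x = 1
      · exact h₁ ▸ f₁
      apply blue x hx
    all_goals omega
  have blue' : ∀ x < 2 * k + 1, x ≠ k - 1 → Forced G Z (x : ZMod (2 * k + 1)) := by
    intro x hx h₃
    by_cases h₁ : x = 1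
    · exact h₁ ▸ f₁
    by_cases h₂ : x = k + 2
    · exact h₂ ▸ f₂
    exact blue x hx h₁ h₃ h₂
  intro v hv
  by_cases h₃ : v = k - 1
  · subst h₃
    exact Forced.natCast_of_adj (u := k) (blue' _ (by omega) (by omega))
      ((adj (by omega) (by omega)).2 (by omega)) fun x hx hxw _ => blue' x hx hxw
  · exact blue' v hv h₃

theorem stmt14 (n : ℕ) (hn : 9 < n) :
    zfn (circG n (Set.Icc 1 ((n + 1) / 2 - 1) \ {(n + 1) / 2 - 2})) ≤
      2 * ((n + 1) / 2 - 2) := by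
  obtain ⟨k, rfl | rfl⟩ := n.even_or_odd'
  · have h := zfn_circG_even_le (k := k) (by omega)
    rw [show (2 * k + 1) / 2 = k by omega]
    omega
  · have h := zfn_circG_odd_le (k := k) (by omega)
    rw [show (2 * k + 1 + 1) / 2 = k + 1 by omega, Nat.add_sub_cancel,
      show k + 1 - 2 = k - 1 by omega]
    omega

end Paper
end
end
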